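/- arXiv:1905.06223 — 10 statements merged into one kernel-verified Lean document; each statement's English description precedes it below -/
import Mathlib

section
/- Let d be a positive integer and let n₁, n₂ ≤ d be natural numbers. If P and Q are d×d complex matrices that are orthogonal projections (P = P† = P², Q = Q† = Q²) with rank P = n₁ and rank Q = n₂, then Tr(PQ) is a real number satisfying max(0, n₁ + n₂ − d) ≤ Tr(PQ) ≤ min(n₁, n₂). -/
open Matrix
open scoped Pointwise

/-- `P` is an orthogonal projection matrix: `P = P† = P²`. -/
def IsProjn {d : ℕ} (P : Matrix (Fin d) (Fin d) ℂ) : Prop :=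
  P.IsHermitian ∧ P * P = P

/-- The trace of an idempotent matrix over a field is its rank. -/
theorem Matrix.trace_eq_rank_of_isIdempotentElem {n K : Type*} [Fintype n] [DecidableEq n]
    [Field K] {A : Matrix n n K} (hA : IsIdempotentElem A) : A.trace = A.rank := by
  have h : IsIdempotentElem (Matrix.toLin' A) := by
    rw [IsIdempotentElem, Module.End.mul_eq_comp, ← Matrix.toLin'_mul, hA.eq]
  rw [← Matrix.trace_toLin'_eq,
    (LinearMap.IsIdempotentElem.isProj_range _ h).trace, Matrix.rank, Matrix.toLin'_apply']

theorem IsProjn.one_sub {d : ℕ} {P : Matrix (Fin d) (Fin d) ℂ} (hP : IsProjn P) :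
    IsProjn (1 - P) :=
  ⟨Matrix.isHermitian_one.sub hP.1, IsIdempotentElem.one_sub hP.2⟩

open scoped ComplexOrder in
/-- The trace of a product of two orthogonal projections is real and nonnegative. -/
theorem IsProjn.trace_mul_nonneg {d : ℕ} {P Q : Matrix (Fin d) (Fin d) ℂ}
    (hP : IsProjn P) (hQ : IsProjn Q) : 0 ≤ (P * Q).trace := by
  have h := (Matrix.posSemidef_conjTranspose_mul_self (P * Q)).trace_nonneg
  rwa [Matrix.conjTranspose_mul, hP.1.eq, hQ.1.eq, Matrix.mul_assoc, ← Matrix.mul_assoc P P Q,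
    hP.2, Matrix.trace_mul_comm, Matrix.mul_assoc, hQ.2] at h

/-- Bound half of Lemma 2.4: for `d × d` orthogonal projections `P`, `Q` of ranks
`n₁, n₂ ≤ d`, the trace `Tr(PQ)` is real and satisfies
`max(0, n₁ + n₂ − d) ≤ Tr(PQ) ≤ min(n₁, n₂)`. -/
theorem trace_prod_projections_bounds (d n₁ n₂ : ℕ) (hd : 0 < d)
    (h₁ : n₁ ≤ d) (h₂ : n₂ ≤ d)
    (P Q : Matrix (Fin d) (Fin d) ℂ) (hP : IsProjn P) (hQ : IsProjn Q)
    (hrP : P.rank = n₁) (hrQ : Q.rank = n₂) :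
    ((P * Q).trace).im = 0 ∧
      max 0 ((n₁ : ℝ) + (n₂ : ℝ) - (d : ℝ)) ≤ ((P * Q).trace).re ∧
      ((P * Q).trace).re ≤ min (n₁ : ℝ) (n₂ : ℝ) := by
  have trP : P.trace = n₁ := hrP ▸ Matrix.trace_eq_rank_of_isIdempotentElem hP.2
  have trQ : Q.trace = n₂ := hrQ ▸ Matrix.trace_eq_rank_of_isIdempotentElem hQ.2
  have hPQ := Complex.le_def.1 (hP.trace_mul_nonneg hQ)
  have h_compl_right := (Complex.le_def.1 (hP.trace_mul_nonneg hQ.one_sub)).1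
  have h_compl_left := (Complex.le_def.1 (hP.one_sub.trace_mul_nonneg hQ)).1
  have h_compl_compl := (Complex.le_def.1 (hP.one_sub.trace_mul_nonneg hQ.one_sub)).1
  simp only [mul_sub, sub_mul, mul_one, one_mul, Matrix.trace_sub, Matrix.trace_one, trP, trQ,
    Fintype.card_fin, Complex.sub_re, Complex.natCast_re, Complex.zero_re] at h_compl_right h_compl_left h_compl_compl
  exact ⟨hPQ.2.symm, max_le hPQ.1 (by linarith), le_min (by linarith) (by linarith)⟩
end

section
/- Let d be a positive integer and let n₁, n₂ ≤ d be natural numbers. For every real number t with max(0, n₁ + n₂ − d) ≤ t ≤ min(n₁, n₂), there exist d×d complex matrices P and Q that are orthogonal projections with rank P = n₁ and rank Q = n₂ such that Re Tr(PQ) = t. -/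
open Matrix
open scoped Pointwise

/-- The projection onto the span of the first `n` standard basis vectors. -/
noncomputable def initialProjn (d n : ℕ) : Matrix (Fin d) (Fin d) ℂ :=
  diagonal fun i => if (i : ℕ) < n then 1 else 0

/-- The permutation matrix reversing the standard basis. -/
def reversal (d : ℕ) : Matrix (Fin d) (Fin d) ℂ :=
  (1 : Matrix (Fin d) (Fin d) ℂ).submatrix Fin.rev id

/-- For `a ^ 2 + b ^ 2 = 1`, a unitary interpolating between the identity and the reversal. -/
noncomputable def partialReversal (d : ℕ) (a b : ℝ) : Matrix (Fin d) (Fin d) ℂ :=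
  (a : ℂ) • 1 + (b * Complex.I : ℂ) • reversal d

theorem card_filter_fin_val (d : ℕ) (p : ℕ → Prop) [DecidablePred p] :
    (Finset.univ.filter fun i : Fin d => p i).card = ((Finset.range d).filter p).card := by
  rw [Finset.card_filter, Finset.card_filter, Finset.sum_range]

theorem card_filter_lt_lt {d m n : ℕ} (hm : m ≤ d) :
    (Finset.univ.filter fun i : Fin d => (i : ℕ) < m ∧ (i : ℕ) < n).card = min m n := by
  rw [card_filter_fin_val d fun i => i < m ∧ i < n, ← Finset.card_range (min m n)]
  congr 1
  ext i
  simp only [Finset.mem_filter, Finset.mem_range]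
  omega

theorem card_filter_lt_rev_lt {d m n : ℕ} (hm : m ≤ d) (hn : n ≤ d) :
    (Finset.univ.filter fun i : Fin d => (i : ℕ) < m ∧ (i.rev : ℕ) < n).card = m + n - d := by
  simp only [Fin.val_rev]
  rw [card_filter_fin_val d fun i => i < m ∧ d - (i + 1) < n]
  have : (Finset.range d).filter (fun i => i < m ∧ d - (i + 1) < n) = Finset.Ico (d - n) m := by
    ext i
    simp only [Finset.mem_filter, Finset.mem_range, Finset.mem_Ico]
    omega
  rw [this, Nat.card_Ico]
  omega

theorem isProjn_initialProjn (d n : ℕ) : IsProjn (initialProjn d n) := by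
  constructor
  · rw [initialProjn, IsHermitian, diagonal_conjTranspose]
    congr 1
    ext i
    simp [apply_ite star]
  · simp [initialProjn]

theorem rank_initialProjn {d n : ℕ} (hn : n ≤ d) : (initialProjn d n).rank = n := by
  classical
  rw [initialProjn, rank_diagonal, Fintype.card_subtype]
  simpa using card_filter_lt_lt (n := n) hn

theorem reversal_mul_self (d : ℕ) : reversal d * reversal d = 1 := by
  ext i j
  simp [reversal, mul_apply, one_apply, Fin.rev_eq_iff]

theorem isHermitian_reversal (d : ℕ) : (reversal d).IsHermitian := by
  ext i j
  simp [reversal, one_apply, apply_ite star, Fin.rev_eq_iff, eq_comm (a := j)]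

theorem reversal_mul_diagonal_mul_reversal {d : ℕ} (w : Fin d → ℂ) :
    reversal d * diagonal w * reversal d = diagonal (w ∘ Fin.rev) := by
  ext i j
  simp [reversal, mul_apply, one_apply, diagonal_apply, Fin.rev_eq_iff]
  grind

theorem conjTranspose_partialReversal (d : ℕ) (a b : ℝ) :
    (partialReversal d a b)ᴴ = (a : ℂ) • 1 - (b * Complex.I : ℂ) • reversal d := by
  simp [partialReversal, (isHermitian_reversal d).eq, sub_eq_add_neg]

theorem partialReversal_mul_conjTranspose (d : ℕ) {a b : ℝ} (hab : a ^ 2 + b ^ 2 = 1) :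
    partialReversal d a b * (partialReversal d a b)ᴴ = 1 := by
  have h : (a * a - b * Complex.I * (b * Complex.I) : ℂ) = 1 := by
    have : (a ^ 2 + b ^ 2 : ℂ) = 1 := mod_cast hab
    linear_combination this - (b : ℂ) ^ 2 * Complex.I_sq
  rw [conjTranspose_partialReversal, partialReversal]
  calc _ = (a * a - b * Complex.I * (b * Complex.I) : ℂ) • (1 : Matrix (Fin d) (Fin d) ℂ) := by
        simp only [add_mul, mul_sub, smul_mul_smul_comm, one_mul, mul_one, reversal_mul_self]
        module
    _ = 1 := by rw [h, one_smul]

theorem IsProjn.unitary_conj {d : ℕ} {P U : Matrix (Fin d) (Fin d) ℂ} (hP : IsProjn P)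
    (hU : U * Uᴴ = 1) : IsProjn (U * P * Uᴴ) := by
  refine ⟨isHermitian_mul_mul_conjTranspose U hP.1, ?_⟩
  calc U * P * Uᴴ * (U * P * Uᴴ) = U * P * (Uᴴ * U) * P * Uᴴ := by simp only [Matrix.mul_assoc]
    _ = U * P * Uᴴ := by
      rw [mul_eq_one_comm.mp hU, Matrix.mul_one, Matrix.mul_assoc U P P, hP.2]

theorem rank_unitary_conj {d : ℕ} (P : Matrix (Fin d) (Fin d) ℂ) {U : Matrix (Fin d) (Fin d) ℂ}
    (hU : U * Uᴴ = 1) : (U * P * Uᴴ).rank = P.rank := by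
  rw [rank_mul_eq_left_of_isUnit_det _ _ (isUnit_det_of_left_inverse hU),
    rank_mul_eq_right_of_isUnit_det _ _ (isUnit_det_of_right_inverse hU)]

theorem trace_diagonal_mul_partialReversal_conj {d : ℕ} (v w : Fin d → ℂ) (a b : ℝ) :
    (diagonal v * (partialReversal d a b * diagonal w * (partialReversal d a b)ᴴ)).trace =
      (a : ℂ) ^ 2 * ∑ i, v i * w i + (b : ℂ) ^ 2 * ∑ i, v i * w i.rev := by
  have hcomm : (diagonal v * (reversal d * diagonal w)).trace =
      (diagonal v * (diagonal w * reversal d)).trace := by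
    rw [← Matrix.mul_assoc, trace_mul_comm, ← Matrix.mul_assoc, ← Matrix.mul_assoc,
      (commute_diagonal v w).eq]
  have hexpand : partialReversal d a b * diagonal w * (partialReversal d a b)ᴴ =
      ((a : ℂ) ^ 2) • diagonal w + ((b : ℂ) ^ 2) • diagonal (w ∘ Fin.rev) +
        (a * b * Complex.I : ℂ) • (reversal d * diagonal w - diagonal w * reversal d) := by
    have hb : (b : ℂ) ^ 2 = -(b * Complex.I * (b * Complex.I)) := by
      linear_combination (b : ℂ) ^ 2 * Complex.I_sq
    rw [conjTranspose_partialReversal, partialReversal, ← reversal_mul_diagonal_mul_reversal, hb]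
    simp only [add_mul, mul_sub, smul_mul_assoc, mul_smul_comm, one_mul, mul_one]
    module
  rw [hexpand]
  simp only [mul_add, mul_sub, mul_smul_comm, trace_add, trace_sub, trace_smul, hcomm,
    diagonal_mul_diagonal, trace_diagonal, smul_eq_mul, Function.comp_apply]
  ring

theorem trace_initialProjn_mul_partialReversal_conj {d m n : ℕ} (hm : m ≤ d) (hn : n ≤ d)
    (a b : ℝ) :
    (initialProjn d m *
        (partialReversal d a b * initialProjn d n * (partialReversal d a b)ᴴ)).trace =
      (a : ℂ) ^ 2 * (min m n : ℕ) + (b : ℂ) ^ 2 * (m + n - d : ℕ) := by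
  rw [initialProjn, initialProjn, trace_diagonal_mul_partialReversal_conj,
    ← card_filter_lt_lt hm, ← card_filter_lt_rev_lt hm hn]
  simp only [Finset.card_filter, Nat.cast_sum, ite_and, Nat.cast_ite, Nat.cast_one, Nat.cast_zero,
    ite_mul, one_mul, zero_mul]

/-- Attainment half of Lemma 2.4: every value in
`[max(0, n₁ + n₂ − d), min(n₁, n₂)]` arises as `Re Tr(PQ)` for `d × d` orthogonal
projections `P`, `Q` of ranks `n₁` and `n₂`. -/
theorem trace_prod_projections_attained (d n₁ n₂ : ℕ) (hd : 0 < d)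
    (h₁ : n₁ ≤ d) (h₂ : n₂ ≤ d) (t : ℝ)
    (hlow : max 0 ((n₁ : ℝ) + (n₂ : ℝ) - (d : ℝ)) ≤ t)
    (hhigh : t ≤ min (n₁ : ℝ) (n₂ : ℝ)) :
    ∃ P Q : Matrix (Fin d) (Fin d) ℂ,
      IsProjn P ∧ IsProjn Q ∧ P.rank = n₁ ∧ Q.rank = n₂ ∧
      ((P * Q).trace).re = t := by
  have hmin : ((min n₁ n₂ : ℕ) : ℝ) = min (n₁ : ℝ) n₂ := Nat.cast_min ..
  have hsub : ((n₁ + n₂ - d : ℕ) : ℝ) = max 0 ((n₁ : ℝ) + n₂ - d) := by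
    rcases le_total d (n₁ + n₂) with h | h
    · have h' : (d : ℝ) ≤ n₁ + n₂ := mod_cast h
      rw [Nat.cast_sub h, Nat.cast_add, max_eq_right (by linarith)]
    · have h' : (n₁ + n₂ : ℝ) ≤ d := mod_cast h
      rw [Nat.sub_eq_zero_of_le h, Nat.cast_zero, max_eq_left (by linarith)]
  have ht : t ∈ segment ℝ ((min n₁ n₂ : ℕ) : ℝ) ((n₁ + n₂ - d : ℕ) : ℝ) := by
    rw [segment_symm, hmin, hsub, segment_eq_Icc (hlow.trans hhigh)]
    exact ⟨hlow, hhigh⟩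
  obtain ⟨x, y, hx, hy, hxy, rfl⟩ := ht
  have hU := partialReversal_mul_conjTranspose d (a := √x) (b := √y)
    (by rw [Real.sq_sqrt hx, Real.sq_sqrt hy, hxy])
  refine ⟨initialProjn d n₁, _, isProjn_initialProjn d n₁,
    (isProjn_initialProjn d n₂).unitary_conj hU, rank_initialProjn h₁,
    (rank_unitary_conj _ hU).trans (rank_initialProjn h₂), ?_⟩
  rw [trace_initialProjn_mul_partialReversal_conj h₁ h₂, ← Complex.ofReal_pow,
    ← Complex.ofReal_pow, Real.sq_sqrt hx, Real.sq_sqrt hy]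
  simp [-Nat.cast_min]
end

section
/- Let q be a 3×3 real symmetric positive semidefinite matrix with all diagonal entries equal to 1. Then there exist 2×2 complex matrices P₁, P₂, P₃ that are orthogonal projections of rank one such that for all i ≠ j, Re Tr(PᵢPⱼ) · (1/2) = (q(i,j) + 1)/4, i.e., the normalized trace tr₂(PᵢPⱼ) equals (q(i,j)+1)/4. -/
open Matrix
open scoped Pointwise

/-- The rank of an idempotent matrix is its trace. -/
theorem Matrix.natCast_rank_of_isIdempotentElem {n K : Type*} [Fintype n] [Field K]
    {P : Matrix n n K} (hP : IsIdempotentElem P) : (P.rank : K) = P.trace := by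
  classical
  have h : IsIdempotentElem (toLin' P) := by
    rw [IsIdempotentElem, Module.End.mul_eq_comp, ← toLin'_mul, hP.eq]
  rw [← trace_toLin'_eq, ((LinearMap.isProj_range_iff_isIdempotentElem _).2 h).trace,
    Matrix.rank, toLin'_apply']

open scoped ComplexOrder MatrixOrder Matrix.Norms.L2Operator in
/-- A positive semidefinite matrix is the Gram matrix of a family of vectors. -/
theorem Matrix.PosSemidef.exists_eq_conjTranspose_mul_self {n 𝕜 : Type*} [Fintype n] [RCLike 𝕜]
    {A : Matrix n n 𝕜} (hA : A.PosSemidef) : ∃ B : Matrix n n 𝕜, A = Bᴴ * B := by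
  classical
  exact CStarAlgebra.nonneg_iff_eq_star_mul_self.mp hA.nonneg

/-- The matrix `(1 + v₀ X + v₁ Y + v₂ Z) / 2`, with `X`, `Y`, `Z` the Pauli matrices. -/
noncomputable def blochMatrix (v : Fin 3 → ℝ) : Matrix (Fin 2) (Fin 2) ℂ :=
  !![(1 + v 2) / 2, (v 0 - v 1 * Complex.I) / 2; (v 0 + v 1 * Complex.I) / 2, (1 - v 2) / 2]

theorem trace_blochMatrix (v : Fin 3 → ℝ) : (blochMatrix v).trace = 1 := by
  simp only [blochMatrix, trace_fin_two_of]
  ring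

theorem trace_blochMatrix_mul (v w : Fin 3 → ℝ) :
    (blochMatrix v * blochMatrix w).trace = ((1 + v ⬝ᵥ w) / 2 : ℝ) := by
  simp only [blochMatrix, mul_fin_two, trace_fin_two_of, dotProduct, Fin.sum_univ_three]
  push_cast
  linear_combination (-(v 1 : ℂ) * w 1 / 2) * Complex.I_sq

theorem isProjn_blochMatrix {v : Fin 3 → ℝ} (hv : v ⬝ᵥ v = 1) : IsProjn (blochMatrix v) := by
  have hv' : (v 0 : ℂ) * v 0 + v 1 * v 1 + v 2 * v 2 = 1 := by
    simpa [dotProduct, Fin.sum_univ_three] using congrArg (fun x : ℝ => (x : ℂ)) hv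
  constructor
  · ext i j
    fin_cases i <;> fin_cases j <;> simp [blochMatrix, sub_eq_add_neg]
  · ext i j
    fin_cases i <;> fin_cases j <;> simp [blochMatrix]
    · linear_combination hv' / 4 - (v 1 : ℂ) ^ 2 / 4 * Complex.I_sq
    · ring
    · ring
    · linear_combination hv' / 4 - (v 1 : ℂ) ^ 2 / 4 * Complex.I_sq

theorem rank_blochMatrix {v : Fin 3 → ℝ} (hv : v ⬝ᵥ v = 1) : (blochMatrix v).rank = 1 := by
  have h := natCast_rank_of_isIdempotentElem (isProjn_blochMatrix hv).2
  rw [trace_blochMatrix] at h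
  exact_mod_cast h

/-- Forward direction of Proposition 3.2: every matrix in the `3 × 3` elliptope arises
from rank-one qubit projections: `tr₂(PᵢPⱼ) = (qᵢⱼ + 1)/4` for `i ≠ j`. -/
theorem elliptope_to_qubit_projections (q : Matrix (Fin 3) (Fin 3) ℝ)
    (hq : q.PosSemidef) (hdiag : ∀ i, q i i = 1) :
    ∃ P : Fin 3 → Matrix (Fin 2) (Fin 2) ℂ,
      (∀ i, IsProjn (P i)) ∧ (∀ i, (P i).rank = 1) ∧
      ∀ i j, i ≠ j → (1 / 2 : ℝ) * (((P i * P j)).trace).re = (q i j + 1) / 4 := by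
  obtain ⟨B, rfl⟩ := hq.exists_eq_conjTranspose_mul_self
  have hB (i j : Fin 3) : B.col i ⬝ᵥ B.col j = (Bᴴ * B) i j := rfl
  have hunit (i : Fin 3) : B.col i ⬝ᵥ B.col i = 1 := (hB i i).trans (hdiag i)
  refine ⟨fun i => blochMatrix (B.col i), fun i => isProjn_blochMatrix (hunit i),
    fun i => rank_blochMatrix (hunit i), fun i j _ => ?_⟩
  rw [trace_blochMatrix_mul, Complex.ofReal_re, hB]
  ring
end

section
/- Let d be a positive integer, let P₁, P₂, P₃ be d×d complex matrices that are orthogonal projections, and let ρ be a positive semidefinite d×d complex matrix with Tr ρ = 1 that commutes with each Pᵢ. Suppose Re Tr(ρPᵢ) = 1/2 for i = 1,2,3. Then there exists a 3×3 real symmetric positive semidefinite matrix q with all diagonal entries equal to 1 such that Re Tr(ρ PᵢPⱼ) = (q(i,j) + 1)/4 for all i ≠ j. -/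
open Matrix
open scoped Pointwise ComplexOrder

/-- The Gram matrix of Hermitian matrices `U i` for the real part of the sesquilinear form
`(A, B) ↦ Tr (ρ A B)` is positive semidefinite. -/
theorem posSemidef_of_re_trace_mul {n ι : Type*} [Fintype n] [Fintype ι]
    {ρ : Matrix n n ℂ} (hρ : ρ.PosSemidef) {U : ι → Matrix n n ℂ}
    (hU : ∀ i, (U i).IsHermitian) :
    (Matrix.of fun i j => ((ρ * (U i * U j)).trace).re).PosSemidef := by
  refine Matrix.PosSemidef.of_dotProduct_mulVec_nonneg ?_ fun x => ?_
  · ext i j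
    have h : star (ρ * (U j * U i)).trace = (ρ * (U i * U j)).trace := by
      rw [← Matrix.trace_conjTranspose, Matrix.conjTranspose_mul, Matrix.conjTranspose_mul,
        (hU i).eq, (hU j).eq, hρ.isHermitian.eq, Matrix.trace_mul_comm]
    simp only [Matrix.conjTranspose_apply, Matrix.of_apply, star_trivial, ← h]
    simp
  · set V : Matrix n n ℂ := ∑ i, (x i : ℂ) • U i with hV
    have hVh : Vᴴ = V := by
      simp only [hV, Matrix.conjTranspose_sum, Matrix.conjTranspose_smul, (hU _).eq]
      simp
    have hnonneg : 0 ≤ ((ρ * (V * V)).trace).re := by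
      have h := (hρ.mul_mul_conjTranspose_same V).trace_nonneg
      rw [hVh, Matrix.mul_assoc, Matrix.trace_mul_comm, Matrix.mul_assoc] at h
      exact (Complex.le_def.mp h).1
    refine hnonneg.trans_eq (Eq.symm ?_)
    simp only [hV, dotProduct, Matrix.mulVec, Matrix.of_apply, Finset.sum_mul, Finset.mul_sum,
      Matrix.trace_sum, Complex.re_sum, Matrix.smul_mul, Matrix.mul_smul, Matrix.trace_smul,
      smul_eq_mul, Complex.re_ofReal_mul, star_trivial]
    rw [Finset.sum_comm]
    refine Finset.sum_congr rfl fun i _ => Finset.sum_congr rfl fun j _ => ?_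
    ring

/-- Converse direction of Proposition 3.2: a synchronous quantum correlation with all
marginals `1/2` lies in the affine image of the `3 × 3` elliptope. -/
theorem half_marginals_to_elliptope (d : ℕ) (hd : 0 < d)
    (P : Fin 3 → Matrix (Fin d) (Fin d) ℂ) (hP : ∀ i, IsProjn (P i))
    (ρ : Matrix (Fin d) (Fin d) ℂ) (hρ : ρ.PosSemidef) (htr : ρ.trace = 1)
    (hcomm : ∀ i, Commute ρ (P i))
    (hmarg : ∀ i, ((ρ * P i).trace).re = 1 / 2) :
    ∃ q : Matrix (Fin 3) (Fin 3) ℝ, q.PosSemidef ∧ (∀ i, q i i = 1) ∧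
      ∀ i j, i ≠ j → ((ρ * (P i * P j)).trace).re = (q i j + 1) / 4 := by
  have key : ∀ i j, ((ρ * ((2 * P i - 1) * (2 * P j - 1))).trace).re =
      4 * ((ρ * (P i * P j)).trace).re - 1 := fun i j => by
    have h : ρ * ((2 * P i - 1) * (2 * P j - 1)) =
        (4 : ℝ) • (ρ * (P i * P j)) - (2 : ℝ) • (ρ * P i) - (2 : ℝ) • (ρ * P j) + ρ := by
      simp only [two_mul, Matrix.mul_sub, Matrix.sub_mul, Matrix.mul_add, Matrix.add_mul,
        Matrix.one_mul, Matrix.mul_one]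
      module
    rw [h]
    simp only [Matrix.trace_add, Matrix.trace_sub, Matrix.trace_smul, Complex.add_re,
      Complex.sub_re, Complex.smul_re, smul_eq_mul, hmarg, htr, Complex.one_re]
    ring
  refine ⟨_, posSemidef_of_re_trace_mul hρ (U := fun i => 2 * P i - 1) fun i => ?_,
    fun i => ?_, fun i j _ => ?_⟩
  · rw [two_mul]
    exact ((hP i).1.add (hP i).1).sub Matrix.isHermitian_one
  · rw [Matrix.of_apply, key, (hP i).2, hmarg]
    norm_num
  · rw [Matrix.of_apply, key]
    ring
end

section
/- Let n₁, n₂, n₃, d be positive integers with each nᵢ ≤ d and n₁ + n₂ < d. Then S_d(n₁,n₂,n₃) ⊆ ((d−1)/d) · co{ S_{d−1}(n₁,n₂,n₃), S_{d−1}(n₁,n₂,n₃−1) }. Equivalently: for all d×d orthogonal projections P₁,P₂,P₃ of ranks n₁,n₂,n₃, there exist t ∈ [0,1], (d−1)×(d−1) orthogonal projections Q₁,Q₂,Q₃ of ranks n₁,n₂,n₃ and (d−1)×(d−1) orthogonal projections R₁,R₂,R₃ of ranks n₁,n₂,n₃−1 with Q₁=R₁, Q₂=R₂, such that ((1/d)Re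 Tr(P₁P₂), (1/d)Re Tr(P₁P₃), (1/d)Re Tr(P₂P₃)) = t·((d−1)/d)·((1/(d−1))Re Tr(Q₁Q₂), (1/(d−1))Re Tr(Q₁Q₃), (1/(d−1))Re Tr(Q₂Q₃)) + (1−t)·((d−1)/d)·((1/(d−1))Re Tr(R₁R₂), (1/(d−1))Re Tr(R₁R₃), (1/(d−1))Re Tr(R₂R₃)). -/
open Matrix
open scoped Pointwise ComplexOrder

/-- `corrSet d n₁ n₂ n₃` is the set `S_d(n₁,n₂,n₃) ⊆ ℝ³` of triples of normalized
traces of pairwise products of orthogonal projections of the prescribed ranks. -/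
def corrSet (d n₁ n₂ n₃ : ℕ) : Set (ℝ × ℝ × ℝ) :=
  { x | ∃ P₁ P₂ P₃ : Matrix (Fin d) (Fin d) ℂ,
      IsProjn P₁ ∧ IsProjn P₂ ∧ IsProjn P₃ ∧
      P₁.rank = n₁ ∧ P₂.rank = n₂ ∧ P₃.rank = n₃ ∧
      x = ((1 / (d : ℝ)) * ((P₁ * P₂).trace).re,
           (1 / (d : ℝ)) * ((P₁ * P₃).trace).re,
           (1 / (d : ℝ)) * ((P₂ * P₃).trace).re) }

theorem IsProjn.trace_eq_rank {d : ℕ} {P : Matrix (Fin d) (Fin d) ℂ} (hP : IsProjn P) :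
    P.trace = P.rank := by
  have h : IsIdempotentElem (Matrix.toLin' P) := by
    rw [IsIdempotentElem, Module.End.mul_eq_comp, ← Matrix.toLin'_mul, hP.2]
  rw [← Matrix.trace_toLin'_eq, (LinearMap.IsIdempotentElem.isProj_range _ h).trace]
  rfl

/-- Two square matrices whose ranks add up to less than the dimension have a common kernel
vector. -/
theorem exists_common_kernel_vector {d : ℕ} (A B : Matrix (Fin d) (Fin d) ℂ)
    (h : A.rank + B.rank < d) : ∃ x : Fin d → ℂ, x ≠ 0 ∧ A *ᵥ x = 0 ∧ B *ᵥ x = 0 := by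
  have hA := A.mulVecLin.finrank_range_add_finrank_ker
  have hB := B.mulVecLin.finrank_range_add_finrank_ker
  have hAB := Submodule.finrank_sup_add_finrank_inf_eq A.mulVecLin.ker B.mulVecLin.ker
  have hle := Submodule.finrank_le (A.mulVecLin.ker ⊔ B.mulVecLin.ker)
  simp only [Module.finrank_fin_fun] at hA hB hle
  unfold Matrix.rank at h
  have hne : A.mulVecLin.ker ⊓ B.mulVecLin.ker ≠ ⊥ := by
    intro h0
    rw [h0, finrank_bot] at hAB
    omega
  obtain ⟨x, hx, hx0⟩ := Submodule.exists_mem_ne_zero_of_ne_bot hne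
  exact ⟨x, hx0, by simpa using hx.1, by simpa using hx.2⟩

/-- For any nonzero vector `x`, with normalization `v`, the projection `1 - v * vᴴ` onto the
orthogonal complement of `x` factors through one dimension lower. -/
theorem exists_factorization_complement_of_ne_zero {k : ℕ} {x : Fin (k + 1) → ℂ} (hx : x ≠ 0) :
    ∃ (V : Matrix (Fin (k + 1)) (Fin k) ℂ) (v : Matrix (Fin (k + 1)) Unit ℂ) (c : ℂ),
      v = c • Matrix.replicateCol Unit x ∧ V * Vᴴ = 1 - v * vᴴ := by
  set y : EuclideanSpace ℂ (Fin (k + 1)) := WithLp.toLp 2 x with hy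
  have hy0 : y ≠ 0 := by simpa [hy] using hx
  have hon : Orthonormal ℂ (({0} : Set (Fin (k + 1))).domRestrict
      (fun _ => ((‖y‖ : ℂ)⁻¹) • y)) := by
    constructor
    · intro i
      simpa using norm_smul_inv_norm (𝕜 := ℂ) hy0
    · intro i j hij
      exact absurd (Subsingleton.elim i j) hij
  obtain ⟨b, hb⟩ := hon.exists_orthonormalBasis_extension_of_card_eq (by simp)
  have hb0 : b 0 = (‖y‖ : ℂ)⁻¹ • y := hb 0 rfl
  set U : Matrix (Fin (k + 1)) (Fin (k + 1)) ℂ := Matrix.of fun i j => b j i with hU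
  have hUU : Uᴴ * U = 1 := by
    ext i j
    have := orthonormal_iff_ite.1 b.orthonormal i j
    simp only [PiLp.inner_apply, RCLike.inner_apply] at this
    simp only [Matrix.mul_apply, Matrix.conjTranspose_apply, hU, Matrix.of_apply, Matrix.one_apply,
      ← this]
    exact Finset.sum_congr rfl fun _ _ => mul_comm _ _
  have hUU' : U * Uᴴ = 1 := mul_eq_one_comm.1 hUU
  refine ⟨U.submatrix id Fin.succ, U.submatrix id fun _ => 0, (‖y‖ : ℂ)⁻¹, ?_, ?_⟩
  · ext i j
    simp [hU, hb0, hy]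
  · ext i j
    have := congr_fun₂ hUU' i j
    rw [Matrix.mul_apply, Fin.sum_univ_succ] at this
    rw [Matrix.sub_apply, ← this]
    simp [Matrix.mul_apply]

section Compression

variable {k : ℕ} {V : Matrix (Fin (k + 1)) (Fin k) ℂ} {v : Matrix (Fin (k + 1)) Unit ℂ}

theorem mul_factor_mul_conjTranspose {P : Matrix (Fin (k + 1)) (Fin (k + 1)) ℂ}
    (hV : V * Vᴴ = 1 - v * vᴴ) (hPv : P * v = 0) : P * (V * Vᴴ) = P := by
  rw [hV, mul_sub, ← Matrix.mul_assoc, hPv]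
  simp

theorem IsProjn.factor_mul_conjTranspose_mul {P : Matrix (Fin (k + 1)) (Fin (k + 1)) ℂ}
    (hP : IsProjn P) (hV : V * Vᴴ = 1 - v * vᴴ) (hPv : P * v = 0) : V * Vᴴ * P = P := by
  have h := congr_arg conjTranspose (mul_factor_mul_conjTranspose hV hPv)
  simpa [Matrix.conjTranspose_mul, hP.1.eq] using h

/-- Compressing to the complement of a kernel vector of `P` preserves trace products with `P`. -/
theorem IsProjn.trace_compress_mul {P : Matrix (Fin (k + 1)) (Fin (k + 1)) ℂ}
    (hP : IsProjn P) (hV : V * Vᴴ = 1 - v * vᴴ) (hPv : P * v = 0)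
    (X : Matrix (Fin (k + 1)) (Fin (k + 1)) ℂ) :
    ((Vᴴ * P * V) * (Vᴴ * X * V)).trace = (P * X).trace := by
  calc ((Vᴴ * P * V) * (Vᴴ * X * V)).trace
      = (Vᴴ * (P * (V * Vᴴ) * X * V)).trace := by simp only [Matrix.mul_assoc]
    _ = ((P * X) * (V * Vᴴ)).trace := by
        rw [mul_factor_mul_conjTranspose hV hPv, Matrix.trace_mul_comm]
        simp only [Matrix.mul_assoc]
    _ = ((V * Vᴴ * P) * X).trace := by
        rw [Matrix.trace_mul_comm]
        simp only [Matrix.mul_assoc]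
    _ = (P * X).trace := by rw [hP.factor_mul_conjTranspose_mul hV hPv]

theorem IsProjn.compress {P : Matrix (Fin (k + 1)) (Fin (k + 1)) ℂ}
    (hP : IsProjn P) (hV : V * Vᴴ = 1 - v * vᴴ) (hPv : P * v = 0) :
    IsProjn (Vᴴ * P * V) := by
  refine ⟨Matrix.isHermitian_conjTranspose_mul_mul V hP.1, ?_⟩
  calc (Vᴴ * P * V) * (Vᴴ * P * V) = Vᴴ * (P * (V * Vᴴ) * P * V) := by
        simp only [Matrix.mul_assoc]
    _ = Vᴴ * P * V := by
        rw [mul_factor_mul_conjTranspose hV hPv, hP.2, Matrix.mul_assoc]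

theorem IsProjn.rank_compress {P : Matrix (Fin (k + 1)) (Fin (k + 1)) ℂ}
    (hP : IsProjn P) (hV : V * Vᴴ = 1 - v * vᴴ) (hPv : P * v = 0) :
    (Vᴴ * P * V).rank = P.rank := by
  have h := hP.trace_compress_mul hV hPv P
  rw [(hP.compress hV hPv).2, hP.2, (hP.compress hV hPv).trace_eq_rank, hP.trace_eq_rank] at h
  exact_mod_cast h

/-- The compression of a projection of rank `n` to a hyperplane is a convex combination of
projections of ranks `n` and `n - 1`. -/
theorem IsProjn.compress_mem_convexHull {P : Matrix (Fin (k + 1)) (Fin (k + 1)) ℂ}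
    (hP : IsProjn P) (hV : V * Vᴴ = 1 - v * vᴴ) :
    Vᴴ * P * V ∈ convexHull ℝ
      {Q : Matrix (Fin k) (Fin k) ℂ | IsProjn Q ∧ (Q.rank = P.rank ∨ Q.rank = P.rank - 1)} := by
  set C := Vᴴ * P * V with hC
  set w := Vᴴ * P * v with hw
  have hCh : C.IsHermitian := Matrix.isHermitian_conjTranspose_mul_mul V hP.1
  have hwh : wᴴ = vᴴ * P * V := by
    simp [hw, Matrix.conjTranspose_mul, hP.1.eq, Matrix.mul_assoc]
  obtain ⟨r, hr⟩ : ∃ r : ℝ, vᴴ * P * v = (r : ℂ) • 1 := by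
    have h := (Matrix.isHermitian_conjTranspose_mul_mul v hP.1).apply () ()
    refine ⟨((vᴴ * P * v) () ()).re, ?_⟩
    ext
    simpa using (Complex.conj_eq_iff_re.1 h).symm
  have key {l m : Type} [Fintype l] [Fintype m] (A : Matrix l (Fin (k + 1)) ℂ)
      (B : Matrix (Fin (k + 1)) m ℂ) :
      (A * P * V) * (Vᴴ * P * B) = A * P * B - (A * P * v) * (vᴴ * P * B) := by
    calc (A * P * V) * (Vᴴ * P * B) = A * P * (V * Vᴴ) * (P * B) := by
          simp only [Matrix.mul_assoc]
      _ = A * (P * P) * B - (A * P * v) * (vᴴ * P * B) := by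
          rw [hV]
          simp only [Matrix.mul_sub, Matrix.sub_mul, Matrix.mul_one, Matrix.mul_assoc]
      _ = _ := by rw [hP.2]
  have hCC : C * C = C - w * wᴴ := by rw [hwh]; exact key _ _
  have hCw : C * w = ((1 - r : ℝ) : ℂ) • w := by
    rw [hC, hw, key, hr]
    simp [sub_smul]
  have hww : wᴴ * w = ((r * (1 - r) : ℝ) : ℂ) • (1 : Matrix Unit Unit ℂ) := by
    rw [hwh, hw, key, hr]
    simp only [Matrix.smul_mul, Matrix.mul_smul, Matrix.one_mul, smul_smul, ← sub_smul]
    congr 1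
    push_cast
    ring
  have htC : C.trace = P.rank - r := by
    have h1 : C.trace = (P * (V * Vᴴ)).trace := by
      rw [hC, Matrix.mul_assoc, Matrix.trace_mul_comm, Matrix.mul_assoc]
    have h2 : (P * (v * vᴴ)).trace = r := by
      rw [← Matrix.mul_assoc, Matrix.trace_mul_comm, ← Matrix.mul_assoc, hr]
      simp
    rw [h1, hV, Matrix.mul_sub, Matrix.trace_sub, h2, Matrix.mul_one, hP.trace_eq_rank]
  have hr0 : 0 ≤ r * (1 - r) := by
    have h := (Matrix.posSemidef_conjTranspose_mul_self w).diag_nonneg (i := ())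
    rw [hww] at h
    simpa only [Matrix.smul_apply, Matrix.one_apply_eq, smul_eq_mul, mul_one,
      Complex.zero_le_real] using h
  by_cases hr1 : r * (1 - r) = 0
  · have hw0 : w = 0 := by
      rw [← Matrix.conjTranspose_mul_self_eq_zero, hww, hr1]
      simp
    have hCp : IsProjn C := ⟨hCh, by rw [hCC, hw0]; simp⟩
    refine subset_convexHull ℝ _ ⟨hCp, ?_⟩
    rw [hCp.trace_eq_rank] at htC
    rcases mul_eq_zero.1 hr1 with h | h
    · left
      rw [h] at htC
      simp only [Complex.ofReal_zero, sub_zero] at htC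
      exact_mod_cast htC
    · right
      rw [show r = 1 by linarith, eq_sub_iff_add_eq] at htC
      have : C.rank + 1 = P.rank := by exact_mod_cast htC
      omega
  have hrpos : 0 < r * (1 - r) := lt_of_le_of_ne hr0 (Ne.symm hr1)
  have hr_pos : 0 < r := by nlinarith
  have hr_lt : 0 < 1 - r := by nlinarith
  set W := w * wᴴ with hW
  have hWh : W.IsHermitian := Matrix.isHermitian_mul_conjTranspose_self w
  have hCW : C * W = (1 - r) • W := by
    rw [hW, ← Matrix.mul_assoc, hCw, Matrix.smul_mul]
    exact Complex.coe_smul _ _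
  have hWC : W * C = (1 - r) • W := by
    have h := congr_arg conjTranspose hCW
    simpa [Matrix.conjTranspose_mul, hCh.eq, hWh.eq] using h
  have hWW : W * W = (r * (1 - r)) • W := by
    rw [hW, Matrix.mul_assoc, ← Matrix.mul_assoc wᴴ, hww, Matrix.smul_mul, Matrix.one_mul,
      Matrix.mul_smul]
    exact Complex.coe_smul _ _
  have htW : W.trace = ((r * (1 - r) : ℝ) : ℂ) := by
    rw [hW, Matrix.trace_mul_comm, hww]
    simp
  have hproj (t : ℝ) (ht : -1 + 2 * t * (1 - r) + t ^ 2 * (r * (1 - r)) = t) :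
      IsProjn (C + t • W) := by
    refine ⟨hCh.add (hWh.smul (IsSelfAdjoint.all t)), ?_⟩
    simp only [add_mul, mul_add, Matrix.smul_mul, Matrix.mul_smul, hCC, hCW, hWC, hWW]
    calc _ = C + (-1 + 2 * t * (1 - r) + t ^ 2 * (r * (1 - r))) • W := by module
      _ = C + t • W := by rw [ht]
  have htr (t : ℝ) : (C + t • W).trace = P.rank - r + t * ((r * (1 - r) : ℝ) : ℂ) := by
    rw [Matrix.trace_add, Matrix.trace_smul, htC, htW]
    simp
  have hQ := hproj (1 - r)⁻¹ (by field_simp; ring)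
  have hR := hproj (-r⁻¹) (by field_simp; ring)
  have hQr : (C + (1 - r)⁻¹ • W).rank = P.rank := by
    have h := htr (1 - r)⁻¹
    rw [hQ.trace_eq_rank, ← Complex.ofReal_mul,
      show (1 - r)⁻¹ * (r * (1 - r)) = r by field_simp] at h
    simp only [sub_add_cancel] at h
    exact_mod_cast h
  have hRr : (C + (-r⁻¹) • W).rank = P.rank - 1 := by
    have h := htr (-r⁻¹)
    rw [hR.trace_eq_rank, ← Complex.ofReal_mul,
      show -r⁻¹ * (r * (1 - r)) = r - 1 by field_simp; ring] at h
    have h' : (((C + (-r⁻¹) • W).rank + 1 : ℕ) : ℂ) = P.rank := by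
      push_cast
      rw [h]
      push_cast
      ring
    have := Nat.cast_injective h'
    omega
  have hcomb : C = (1 - r) • (C + (1 - r)⁻¹ • W) + r • (C + (-r⁻¹) • W) := by
    simp only [smul_add, smul_smul, mul_neg, mul_inv_cancel₀ hr_pos.ne',
      mul_inv_cancel₀ hr_lt.ne']
    module
  rw [hcomb]
  refine convex_convexHull ℝ _ (subset_convexHull ℝ _ ?_) (subset_convexHull ℝ _ ?_)
    hr_lt.le hr_pos.le (by ring)
  exacts [⟨hQ, Or.inl hQr⟩, ⟨hR, Or.inr hRr⟩]

end Compression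

/-- Lemma 3.1 (main dimension-reduction lemma): if `n₁ + n₂ < d` then
`S_d(n₁,n₂,n₃) ⊆ ((d−1)/d) · co(S_{d−1}(n₁,n₂,n₃) ∪ S_{d−1}(n₁,n₂,n₃−1))`. -/
theorem corrSet_reduce_third (n₁ n₂ n₃ d : ℕ)
    (h₁ : 0 < n₁) (h₂ : 0 < n₂) (h₃ : 0 < n₃) (hd : 0 < d)
    (h₁d : n₁ ≤ d) (h₂d : n₂ ≤ d) (h₃d : n₃ ≤ d) (hsum : n₁ + n₂ < d) :
    corrSet d n₁ n₂ n₃ ⊆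
      (((d : ℝ) - 1) / (d : ℝ)) •
        convexHull ℝ (corrSet (d - 1) n₁ n₂ n₃ ∪ corrSet (d - 1) n₁ n₂ (n₃ - 1)) := by
  obtain ⟨k, rfl⟩ : ∃ k, d = k + 1 := ⟨d - 1, by omega⟩
  have hk : (k : ℝ) ≠ 0 := Nat.cast_ne_zero.2 (by omega)
  rintro _ ⟨P₁, P₂, P₃, hP₁, hP₂, hP₃, rfl, rfl, rfl, rfl⟩
  obtain ⟨x, hx, hx₁, hx₂⟩ := exists_common_kernel_vector P₁ P₂ hsum
  obtain ⟨V, v, c, hvx, hV⟩ := exists_factorization_complement_of_ne_zero hx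
  have hv₁ : P₁ * v = 0 := by
    rw [hvx, Matrix.mul_smul, ← Matrix.replicateCol_mulVec, hx₁]
    simp
  have hv₂ : P₂ * v = 0 := by
    rw [hvx, Matrix.mul_smul, ← Matrix.replicateCol_mulVec, hx₂]
    simp
  set Q₁ := Vᴴ * P₁ * V with hQ₁
  set Q₂ := Vᴴ * P₂ * V with hQ₂
  let f (X : Matrix (Fin k) (Fin k) ℂ) : ℝ × ℝ × ℝ :=
    ((1 / (k : ℝ)) * ((Q₁ * Q₂).trace).re, (1 / (k : ℝ)) * ((Q₁ * X).trace).re,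
      (1 / (k : ℝ)) * ((Q₂ * X).trace).re)
  simp only [Nat.add_sub_cancel]
  set S := convexHull ℝ (corrSet k P₁.rank P₂.rank P₃.rank ∪
    corrSet k P₁.rank P₂.rank (P₃.rank - 1)) with hS
  have hf : convexHull ℝ {Q : Matrix (Fin k) (Fin k) ℂ |
      IsProjn Q ∧ (Q.rank = P₃.rank ∨ Q.rank = P₃.rank - 1)} ⊆ f ⁻¹' S := by
    refine convexHull_min ?_ ?_
    · rintro Q ⟨hQ, h⟩
      refine subset_convexHull ℝ _ (h.imp (fun h => ?_) fun h => ?_) <;>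
        exact ⟨Q₁, Q₂, Q, hP₁.compress hV hv₁, hP₂.compress hV hv₂, hQ,
          hP₁.rank_compress hV hv₁, hP₂.rank_compress hV hv₂, h, rfl⟩
    · intro X hX Y hY a b ha hb hab
      have hfab : f (a • X + b • Y) = a • f X + b • f Y := by
        simp only [f, Matrix.mul_add, Matrix.mul_smul, Matrix.trace_add, Matrix.trace_smul,
          Complex.add_re, Complex.smul_re, Prod.smul_mk, Prod.mk_add_mk, smul_eq_mul, ← add_mul,
          hab, one_mul]
        refine Prod.ext rfl (Prod.ext ?_ ?_) <;> simp only <;> ring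
      rw [Set.mem_preimage, hfab]
      exact convex_convexHull ℝ _ hX hY ha hb hab
  refine ⟨f (Vᴴ * P₃ * V), hf (hP₃.compress_mem_convexHull hV), ?_⟩
  have hk' : (k : ℝ) + 1 ≠ 0 := by positivity
  simp only [f, hQ₁, hQ₂, hP₁.trace_compress_mul hV hv₁, hP₂.trace_compress_mul hV hv₂]
  push_cast
  simp only [add_sub_cancel_right, Prod.smul_mk, smul_eq_mul]
  refine Prod.ext ?_ (Prod.ext ?_ ?_) <;> simp only <;> field_simp
end

section
/- Let n₁, n₂, n₃, d be positive integers with each nᵢ ≤ d. Then S_d(n₁,n₂,n₃) ⊆ ((d+1)/d) · S_{d+1}(n₁+1, n₂, n₃), and likewise S_d(n₁,n₂,n₃) ⊆ ((d+1)/d) · S_{d+1}(n₁, n₂+1, n₃) and S_d(n₁,n₂,n₃) ⊆ ((d+1)/d) · S_{d+1}(n₁, n₂, n₃+1). -/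
open Matrix
open scoped Pointwise ComplexOrder

/-- The block diagonal matrix `P ⊕ c`, obtained from `P` by appending the diagonal entry `c`. -/
def padDiag {d : ℕ} (P : Matrix (Fin d) (Fin d) ℂ) (c : ℂ) : Matrix (Fin (d + 1)) (Fin (d + 1)) ℂ :=
  (fromBlocks P 0 0 (diagonal fun _ : Fin 1 => c)).submatrix finSumFinEquiv.symm finSumFinEquiv.symm

theorem padDiag_mul {d : ℕ} (P Q : Matrix (Fin d) (Fin d) ℂ) (a b : ℂ) :
    padDiag P a * padDiag Q b = padDiag (P * Q) (a * b) := by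
  simp [padDiag, submatrix_mul_equiv, fromBlocks_multiply]

theorem trace_padDiag {d : ℕ} (P : Matrix (Fin d) (Fin d) ℂ) (c : ℂ) :
    (padDiag P c).trace = P.trace + c := by
  unfold padDiag trace
  simp only [diag_apply, submatrix_apply]
  rw [Equiv.sum_comp finSumFinEquiv.symm
    (fun i => fromBlocks P 0 0 (diagonal fun _ : Fin 1 => c) i i)]
  simp

theorem trace_eq_rank_of_mul_self {d : ℕ} {P : Matrix (Fin d) (Fin d) ℂ} (h : P * P = P) :
    P.trace = P.rank := by
  have hi : IsIdempotentElem (toLin' P) := by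
    rw [IsIdempotentElem, Module.End.mul_eq_comp, ← toLin'_mul, h]
  have ht := LinearMap.IsProj.trace (LinearMap.IsIdempotentElem.isProj_range _ hi)
  rwa [trace_toLin'_eq] at ht

theorem IsProjn.padDiag {d : ℕ} {P : Matrix (Fin d) (Fin d) ℂ} (hP : IsProjn P) {c : ℂ}
    (hc : star c = c) (hcc : c * c = c) : IsProjn (padDiag P c) := by
  refine ⟨?_, by rw [padDiag_mul, hP.2, hcc]⟩
  refine IsHermitian.submatrix (IsHermitian.fromBlocks hP.1 (by simp) ?_) _
  exact isHermitian_diagonal_of_self_adjoint _ (funext fun _ => hc)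

theorem IsProjn.rank_padDiag_zero {d : ℕ} {P : Matrix (Fin d) (Fin d) ℂ} (hP : IsProjn P) :
    (_root_.padDiag P 0).rank = P.rank := by
  have h := trace_eq_rank_of_mul_self (hP.padDiag (c := 0) (by simp) (by simp)).2
  rw [trace_padDiag, trace_eq_rank_of_mul_self hP.2] at h
  exact_mod_cast h.symm.trans (add_zero _)

theorem IsProjn.rank_padDiag_one {d : ℕ} {P : Matrix (Fin d) (Fin d) ℂ} (hP : IsProjn P) :
    (_root_.padDiag P 1).rank = P.rank + 1 := by
  have h := trace_eq_rank_of_mul_self (hP.padDiag (c := 1) (by simp) (by simp)).2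
  rw [trace_padDiag, trace_eq_rank_of_mul_self hP.2] at h
  exact_mod_cast h.symm

/-- Padding three projections by entries of which any two have product zero only rescales
the normalized correlations. -/
theorem mem_smul_corrSet_of_padDiag {d m₁ m₂ m₃ : ℕ} {P₁ P₂ P₃ : Matrix (Fin d) (Fin d) ℂ}
    {a b c : ℂ} (h₁ : IsProjn (padDiag P₁ a)) (h₂ : IsProjn (padDiag P₂ b))
    (h₃ : IsProjn (padDiag P₃ c)) (r₁ : (padDiag P₁ a).rank = m₁)
    (r₂ : (padDiag P₂ b).rank = m₂) (r₃ : (padDiag P₃ c).rank = m₃)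
    (hab : a * b = 0) (hac : a * c = 0) (hbc : b * c = 0) :
    ((1 / (d : ℝ)) * ((P₁ * P₂).trace).re, (1 / (d : ℝ)) * ((P₁ * P₃).trace).re,
      (1 / (d : ℝ)) * ((P₂ * P₃).trace).re) ∈
      (((d : ℝ) + 1) / (d : ℝ)) • corrSet (d + 1) m₁ m₂ m₃ := by
  refine Set.mem_smul_set.2 ⟨_, ⟨_, _, _, h₁, h₂, h₃, r₁, r₂, r₃, rfl⟩, ?_⟩
  have key (t : ℝ) : ((d : ℝ) + 1) / d * (1 / ((d : ℝ) + 1) * t) = 1 / d * t := by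
    field_simp
  simp only [padDiag_mul, trace_padDiag, hab, hac, hbc, add_zero, Prod.smul_mk, smul_eq_mul,
    Nat.cast_add, Nat.cast_one, key]

/-- Lemma 3.3 (blow-up lemma): `S_d(n₁,n₂,n₃) ⊆ ((d+1)/d) · S_{d+1}(...)` where any one
of the ranks is increased by one. -/
theorem corrSet_blowup (n₁ n₂ n₃ d : ℕ)
    (h₁ : 0 < n₁) (h₂ : 0 < n₂) (h₃ : 0 < n₃) (hd : 0 < d)
    (h₁d : n₁ ≤ d) (h₂d : n₂ ≤ d) (h₃d : n₃ ≤ d) :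
    corrSet d n₁ n₂ n₃ ⊆ (((d : ℝ) + 1) / (d : ℝ)) • corrSet (d + 1) (n₁ + 1) n₂ n₃ ∧
    corrSet d n₁ n₂ n₃ ⊆ (((d : ℝ) + 1) / (d : ℝ)) • corrSet (d + 1) n₁ (n₂ + 1) n₃ ∧
    corrSet d n₁ n₂ n₃ ⊆ (((d : ℝ) + 1) / (d : ℝ)) • corrSet (d + 1) n₁ n₂ (n₃ + 1) := by
  refine ⟨?_, ?_, ?_⟩ <;> rintro _ ⟨P₁, P₂, P₃, p₁, p₂, p₃, rfl, rfl, rfl, rfl⟩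
  · exact mem_smul_corrSet_of_padDiag (p₁.padDiag (c := 1) (by simp) (by simp))
      (p₂.padDiag (c := 0) (by simp) (by simp))
      (p₃.padDiag (c := 0) (by simp) (by simp))
      p₁.rank_padDiag_one p₂.rank_padDiag_zero p₃.rank_padDiag_zero
      (by simp) (by simp) (by simp)
  · exact mem_smul_corrSet_of_padDiag (p₁.padDiag (c := 0) (by simp) (by simp))
      (p₂.padDiag (c := 1) (by simp) (by simp))
      (p₃.padDiag (c := 0) (by simp) (by simp))
      p₁.rank_padDiag_zero p₂.rank_padDiag_one p₃.rank_padDiag_zero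
      (by simp) (by simp) (by simp)
  · exact mem_smul_corrSet_of_padDiag (p₁.padDiag (c := 0) (by simp) (by simp))
      (p₂.padDiag (c := 0) (by simp) (by simp))
      (p₃.padDiag (c := 1) (by simp) (by simp))
      p₁.rank_padDiag_zero p₂.rank_padDiag_zero p₃.rank_padDiag_one
      (by simp) (by simp) (by simp)
end

section
/- Let d ≥ 3 be an integer. Then S_d(1,1,1) ⊆ co{ {(0,0,0)}, (2/d)·S₂(1) }. That is, every triple ((1/d)Re Tr(P₁P₂), (1/d)Re Tr(P₁P₃), (1/d)Re Tr(P₂P₃)) arising from rank-one orthogonal projections P₁,P₂,P₃ in M_d(ℂ) lies in the convex hull in ℝ³ of the origin together with the set (2/d)·S₂(1). -/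
open Matrix
open scoped Pointwise ComplexOrder

/-- A rank-one orthogonal projection is `u u†` for a unit vector `u`. -/
theorem IsProjn.exists_eq_vecMulVec {d : ℕ} {P : Matrix (Fin d) (Fin d) ℂ} (hP : IsProjn P)
    (hr : P.rank = 1) :
    ∃ u : Fin d → ℂ, star u ⬝ᵥ u = 1 ∧ P = vecMulVec u (star u) := by
  obtain ⟨⟨v, y, hy⟩, hv0, hv⟩ := finrank_eq_one_iff'.1 hr
  have hv0' : v ≠ 0 := fun h => hv0 (Subtype.ext h)
  rw [mulVecLin_apply] at hy
  have hPv : P *ᵥ v = v := by rw [← hy, mulVec_mulVec, hP.2]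
  obtain ⟨n, hn, hvn⟩ : ∃ n : ℝ, 0 < n ∧ star v ⬝ᵥ v = n := by
    have h := dotProduct_star_self_pos_iff (v := v) |>.2 hv0'
    rw [Complex.lt_def] at h
    exact ⟨(star v ⬝ᵥ v).re, h.1, Complex.ext rfl h.2.symm⟩
  have hnC : (n : ℂ) ≠ 0 := by exact_mod_cast hn.ne'
  have hs : ((√n : ℝ) : ℂ) * (√n : ℝ) = n := by
    rw [← Complex.ofReal_mul, Real.mul_self_sqrt hn.le]
  have hsC : ((√n : ℝ) : ℂ) ≠ 0 := by exact_mod_cast (Real.sqrt_pos.2 hn).ne'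
  have hstar : star (((√n : ℝ) : ℂ)⁻¹ • v) = ((√n : ℝ) : ℂ)⁻¹ • star v := by
    rw [star_smul, star_inv₀, Complex.star_def, Complex.conj_ofReal]
  have hPn : ∀ w, (n : ℂ) • P *ᵥ w = (star v ⬝ᵥ w) • v := by
    intro w
    obtain ⟨c, hc⟩ := hv ⟨P *ᵥ w, w, rfl⟩
    replace hc : c • v = P *ᵥ w := congrArg Subtype.val hc
    have h : star v ⬝ᵥ (P *ᵥ w) = star v ⬝ᵥ w := by
      rw [dotProduct_mulVec]
      conv_lhs => rw [← hP.1.eq, ← star_mulVec, hPv]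
    rw [← h, ← hc, dotProduct_smul, hvn, smul_smul, smul_eq_mul, mul_comm]
  refine ⟨((√n : ℝ) : ℂ)⁻¹ • v, ?_, ?_⟩
  · rw [hstar, smul_dotProduct, dotProduct_smul, hvn, smul_eq_mul, smul_eq_mul, ← hs]
    field_simp
  · ext i j
    have h := congrFun (hPn (Pi.single j 1)) i
    simp only [mulVec_single_one, dotProduct_single_one, Pi.smul_apply, col_apply, smul_eq_mul,
      Pi.star_apply] at h
    rw [hstar, vecMulVec_apply, Pi.smul_apply, Pi.smul_apply, smul_eq_mul, smul_eq_mul,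
      Pi.star_apply]
    refine mul_left_cancel₀ hnC (h.trans ?_)
    rw [← hs]
    field_simp

theorem trace_vecMulVec_star_mul_re {d : ℕ} (u v : Fin d → ℂ) :
    (vecMulVec u (star u) * vecMulVec v (star v)).trace.re = Complex.normSq (star u ⬝ᵥ v) := by
  have h' : star v ⬝ᵥ u = star (star u ⬝ᵥ v) := by rw [star_dotProduct]
  rw [vecMulVec_mul_vecMulVec, trace_vecMulVec, dotProduct_smul, dotProduct_comm u, h',
    smul_eq_mul, Complex.star_def, Complex.mul_conj, Complex.ofReal_re]

theorem normSq_star_dotProduct_le_one {d : ℕ} {u v : Fin d → ℂ} (hu : star u ⬝ᵥ u = 1)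
    (hv : star v ⬝ᵥ v = 1) : Complex.normSq (star u ⬝ᵥ v) ≤ 1 := by
  have h := (posSemidef_conjTranspose_mul_self (of fun i j => ![u, v] j i)).det_nonneg
  have hG : ∀ i j, ((of fun i j => ![u, v] j i)ᴴ * (of fun i j => ![u, v] j i)) i j
      = star (![u, v] i) ⬝ᵥ ![u, v] j := fun _ _ => rfl
  have h21 : star v ⬝ᵥ u = star (star u ⬝ᵥ v) := by
    rw [star_dotProduct]
  rw [det_fin_two] at h
  simp only [hG, cons_val_zero, cons_val_one, hu, hv, h21] at h
  rw [Complex.star_def, Complex.mul_conj, Complex.le_def] at h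
  simpa using h.1

theorem sum_normSq_star_dotProduct_le {d : ℕ} {u v w : Fin d → ℂ} (hu : star u ⬝ᵥ u = 1)
    (hv : star v ⬝ᵥ v = 1) (hw : star w ⬝ᵥ w = 1) :
    Complex.normSq (star u ⬝ᵥ v) + Complex.normSq (star u ⬝ᵥ w) + Complex.normSq (star v ⬝ᵥ w) - 1
      ≤ 2 * ((star u ⬝ᵥ v) * (star v ⬝ᵥ w) * star (star u ⬝ᵥ w)).re := by
  have h := (posSemidef_conjTranspose_mul_self (of fun i j => ![u, v, w] j i)).det_nonneg
  have hG : ∀ i j, ((of fun i j => ![u, v, w] j i)ᴴ * (of fun i j => ![u, v, w] j i)) i j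
      = star (![u, v, w] i) ⬝ᵥ ![u, v, w] j := fun _ _ => rfl
  have hc : ∀ a b : Fin d → ℂ, star b ⬝ᵥ a = star (star a ⬝ᵥ b) := fun a b => by
    rw [star_dotProduct]
  rw [det_fin_three] at h
  simp only [hG, cons_val_zero, cons_val_one, cons_val, hu, hv, hw, hc u v, hc u w,
    hc v w] at h
  rw [Complex.le_def] at h
  have h := h.1
  simp [Complex.normSq_apply] at h ⊢
  linarith

theorem isProjn_fin_two {a : ℝ} {τ : ℂ} (h : Complex.normSq τ = a * (1 - a)) :
    IsProjn !![(a : ℂ), τ; star τ, 1 - a] := by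
  have h' : τ * star τ = a * (1 - a) := by
    rw [Complex.star_def, Complex.mul_conj, h]; push_cast; rfl
  constructor
  · ext i j
    fin_cases i <;> fin_cases j <;> simp
  · rw [mul_fin_two]
    ext i j
    fin_cases i <;> fin_cases j <;> simp <;> simp at h' <;>
      first | linear_combination h' | linear_combination

theorem eq_zero_of_rank_eq_zero {m n : Type*} [Finite m] [Fintype n] {A : Matrix m n ℂ}
    (h : A.rank = 0) : A = 0 := by
  classical
  have h' := LinearMap.range_eq_bot.1 (Submodule.finrank_eq_zero.1 h)
  ext i j
  simpa using congrFun (LinearMap.congr_fun h' (Pi.single j 1)) i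

theorem rank_fin_two_eq_one {a : ℝ} {τ : ℂ} (h : Complex.normSq τ = a * (1 - a)) :
    (!![(a : ℂ), τ; star τ, 1 - a]).rank = 1 := by
  have hP := (isProjn_fin_two h).2
  set P := !![(a : ℂ), τ; star τ, 1 - a] with hPdef
  have h1 : P.rank ≠ 0 := by
    intro h0
    have : P = 0 := eq_zero_of_rank_eq_zero h0
    have ht := congrArg trace this
    simp [hPdef, trace_fin_two] at ht
  have h2 : (1 - P).rank ≠ 0 := by
    intro h0
    have : 1 - P = 0 := eq_zero_of_rank_eq_zero h0
    have ht := congrArg trace this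
    simp [hPdef, trace_fin_two] at ht
    norm_num at ht
  have h3 := rank_add_rank_le_card_of_mul_eq_zero (A := P) (B := 1 - P)
    (by rw [mul_sub, mul_one, hP, sub_self])
  rw [Fintype.card_fin] at h3
  omega

/-- Every triple of squared overlaps compatible with a singular Gram matrix is realized by
rank-one projections in dimension two. -/
theorem half_smul_mem_corrSet_two {x y z : ℝ} (hx : x ∈ Set.Icc 0 1) (hy : y ∈ Set.Icc 0 1)
    (h : (x + y + z - 1) ^ 2 ≤ 4 * x * y * z) :
    (1 / 2 * x, 1 / 2 * y, 1 / 2 * z) ∈ corrSet 2 1 1 1 := by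
  obtain ⟨hx0, hx1⟩ := hx
  obtain ⟨hy0, hy1⟩ := hy
  have hxx : 0 ≤ x * (1 - x) := mul_nonneg hx0 (by linarith)
  have hyy : 0 ≤ y * (1 - y) := mul_nonneg hy0 (by linarith)
  obtain ⟨s, hs⟩ : ∃ s : ℝ, s * s = x * (1 - x) := ⟨_, Real.mul_self_sqrt hxx⟩
  obtain ⟨r, hr, hr'⟩ : ∃ r : ℝ, 2 * s * r = z - x * y - (1 - x) * (1 - y) ∧
      r ^ 2 ≤ y * (1 - y) := by
    have hq : (z - x * y - (1 - x) * (1 - y)) ^ 2 ≤ 4 * (s * s) * (y * (1 - y)) := by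
      rw [hs]; linarith
    rcases eq_or_ne s 0 with h0 | h0
    · refine ⟨0, ?_, by simpa using hyy⟩
      rw [h0] at hq
      rw [mul_zero, eq_comm]
      exact pow_eq_zero_iff two_ne_zero |>.1 (le_antisymm (by linarith) (sq_nonneg _))
    · refine ⟨(z - x * y - (1 - x) * (1 - y)) / (2 * s), by field_simp, ?_⟩
      rw [div_pow, div_le_iff₀ (by positivity)]
      linarith
  have hτ : Complex.normSq ⟨r, √(y * (1 - y) - r ^ 2)⟩ = y * (1 - y) := by
    rw [Complex.normSq_mk, Real.mul_self_sqrt (by linarith)]; ring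
  have hσ : Complex.normSq (s : ℂ) = x * (1 - x) := by rw [Complex.normSq_ofReal, hs]
  have hζ : Complex.normSq 0 = (1 : ℝ) * (1 - 1) := by simp
  refine ⟨_, _, _, isProjn_fin_two hζ, isProjn_fin_two hσ, isProjn_fin_two hτ,
    rank_fin_two_eq_one hζ, rank_fin_two_eq_one hσ, rank_fin_two_eq_one hτ, ?_⟩
  simp [trace_fin_two]
  linarith

/-- Proposition 3.4: for `d ≥ 3`, `S_d(1,1,1) ⊆ co({0} ∪ (2/d)·S₂(1))`. -/
theorem corrSet_rank_one (d : ℕ) (hd : 3 ≤ d) :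
    corrSet d 1 1 1 ⊆
      convexHull ℝ ({((0 : ℝ), (0 : ℝ), (0 : ℝ))} ∪
        ((2 : ℝ) / (d : ℝ)) • corrSet 2 1 1 1) := by
  rintro _ ⟨P₁, P₂, P₃, h₁, h₂, h₃, r₁, r₂, r₃, rfl⟩
  obtain ⟨u, hu, rfl⟩ := h₁.exists_eq_vecMulVec r₁
  obtain ⟨v, hv, rfl⟩ := h₂.exists_eq_vecMulVec r₂
  obtain ⟨w, hw, rfl⟩ := h₃.exists_eq_vecMulVec r₃
  simp only [trace_vecMulVec_star_mul_re]
  have hdet := sum_normSq_star_dotProduct_le hu hv hw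
  have hx1 := normSq_star_dotProduct_le_one hu hv
  have hy1 := normSq_star_dotProduct_le_one hu hw
  have hx0 := Complex.normSq_nonneg (star u ⬝ᵥ v)
  have hy0 := Complex.normSq_nonneg (star u ⬝ᵥ w)
  have hz0 := Complex.normSq_nonneg (star v ⬝ᵥ w)
  have ht : ((star u ⬝ᵥ v) * (star v ⬝ᵥ w) * star (star u ⬝ᵥ w)).re ^ 2 ≤
      Complex.normSq (star u ⬝ᵥ v) * Complex.normSq (star u ⬝ᵥ w) *
        Complex.normSq (star v ⬝ᵥ w) := by
    have := Complex.re_sq_le_normSq ((star u ⬝ᵥ v) * (star v ⬝ᵥ w) * star (star u ⬝ᵥ w))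
    rw [Complex.normSq_mul, Complex.normSq_mul, Complex.star_def, Complex.normSq_conj] at this
    rw [Complex.star_def]
    linarith
  generalize Complex.normSq (star u ⬝ᵥ v) = x at *
  generalize Complex.normSq (star u ⬝ᵥ w) = y at *
  generalize Complex.normSq (star v ⬝ᵥ w) = z at *
  generalize ((star u ⬝ᵥ v) * (star v ⬝ᵥ w) * star (star u ⬝ᵥ w)).re = t at *
  have hmem : ∀ {a b c : ℝ}, a ∈ Set.Icc 0 1 → b ∈ Set.Icc 0 1 →
      (a + b + c - 1) ^ 2 ≤ 4 * a * b * c →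
      (1 / (d : ℝ) * a, 1 / (d : ℝ) * b, 1 / (d : ℝ) * c) ∈
        convexHull ℝ ({((0 : ℝ), (0 : ℝ), (0 : ℝ))} ∪
          ((2 : ℝ) / (d : ℝ)) • corrSet 2 1 1 1) := by
    intro a b c ha hb h
    refine subset_convexHull ℝ _ (Or.inr ⟨_, half_smul_mem_corrSet_two ha hb h, ?_⟩)
    ext <;> simp <;> ring
  rcases le_or_gt (x + y + z) 1 with hle | hgt
  · have h0 := subset_convexHull ℝ ({((0 : ℝ), (0 : ℝ), (0 : ℝ))} ∪
      ((2 : ℝ) / (d : ℝ)) • corrSet 2 1 1 1) (Or.inl rfl)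
    have he₁ := hmem (a := 1) (b := 0) (c := 0) (by simp) (by simp) (by simp)
    have he₂ := hmem (a := 0) (b := 1) (c := 0) (by simp) (by simp) (by simp)
    have he₃ := hmem (a := 0) (b := 0) (c := 1) (by simp) (by simp) (by simp)
    have hsum := (convex_convexHull ℝ _).sum_mem (t := Finset.univ)
      (w := ![1 - x - y - z, x, y, z])
      (z := ![(0, 0, 0), (1 / (d : ℝ) * 1, 1 / (d : ℝ) * 0, 1 / (d : ℝ) * 0),
        (1 / (d : ℝ) * 0, 1 / (d : ℝ) * 1, 1 / (d : ℝ) * 0),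
        (1 / (d : ℝ) * 0, 1 / (d : ℝ) * 0, 1 / (d : ℝ) * 1)])
      (by intro i _; fin_cases i <;> simp <;> linarith)
      (by simp [Fin.sum_univ_four]; ring)
      (by intro i _; fin_cases i <;> assumption)
    convert hsum using 1
    simp [Fin.sum_univ_four, mul_comm]
  · refine hmem ⟨hx0, hx1⟩ ⟨hy0, hy1⟩ ?_
    have := pow_le_pow_left₀ (by linarith) hdet 2
    linarith
end

section
/- Let n, m, d be positive integers with 2n = d − m, and set l = min(n−1, m). Then S_d(n,n,n) ⊆ co{ ((d−1)/d)·S_{d−1}(n,n,n), ((d−3l)/d)·S_{d−3l}(n−l, n−l, n−l) }. -/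
open Matrix
open scoped Pointwise ComplexOrder

/-! ### Compactness of convex hulls in finite dimension -/

theorem isCompact_convexJoin {E : Type*} [AddCommGroup E] [Module ℝ E] [TopologicalSpace E]
    [IsTopologicalAddGroup E] [ContinuousSMul ℝ E] {s t : Set E}
    (hs : IsCompact s) (ht : IsCompact t) : IsCompact (convexJoin ℝ s t) := by
  have himg : convexJoin ℝ s t =
      (fun p : ℝ × E × E => (1 - p.1) • p.2.1 + p.1 • p.2.2) '' (Set.Icc 0 1 ×ˢ s ×ˢ t) := by
    ext x
    simp only [mem_convexJoin, segment_eq_image, Set.mem_image, Set.mem_prod, Prod.exists]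
    constructor
    · rintro ⟨a, ha, b, hb, θ, hθ, rfl⟩
      exact ⟨θ, a, b, ⟨hθ, ha, hb⟩, rfl⟩
    · rintro ⟨θ, a, b, ⟨hθ, ha, hb⟩, rfl⟩
      exact ⟨a, ha, b, hb, θ, hθ, rfl⟩
  rw [himg]
  exact (isCompact_Icc.prod (hs.prod ht)).image (by fun_prop)

theorem exists_isCompact_between_convexHull {E : Type*} [AddCommGroup E] [Module ℝ E]
    [TopologicalSpace E] [IsTopologicalAddGroup E] [ContinuousSMul ℝ E] {s : Set E}
    (hs : IsCompact s) (k : ℕ) :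
    ∃ C : Set E, IsCompact C ∧ C ⊆ convexHull ℝ s ∧
      ∀ t : Finset E, (t : Set E) ⊆ s → t.card ≤ k → convexHull ℝ (t : Set E) ⊆ C := by
  classical
  induction k with
  | zero =>
    refine ⟨∅, isCompact_empty, Set.empty_subset _, fun t _ ht => ?_⟩
    obtain rfl : t = ∅ := by simpa using ht
    simp
  | succ k ih =>
    obtain ⟨C, hC, hCs, hCt⟩ := ih
    refine ⟨s ∪ convexJoin ℝ s C, hs.union (isCompact_convexJoin hs hC), ?_, ?_⟩
    · exact Set.union_subset (subset_convexHull ℝ s)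
        (convexJoin_subset (subset_convexHull ℝ s) hCs (convex_convexHull ℝ s))
    · intro t hts htk
      obtain rfl | ⟨a, ha⟩ := t.eq_empty_or_nonempty
      · simp
      have hins : (t : Set E) = insert a ((t.erase a : Finset E) : Set E) := by
        rw [← Finset.coe_insert, Finset.insert_erase ha]
      have hsub : ((t.erase a : Finset E) : Set E) ⊆ s :=
        (Finset.coe_subset.2 (Finset.erase_subset a t)).trans hts
      rw [hins]
      obtain he | hne := (t.erase a).eq_empty_or_nonempty
      · rw [he]
        simpa using Or.inl (hts ha)
      · rw [convexHull_insert (by exact_mod_cast hne)]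
        refine Set.subset_union_of_subset_right (convexJoin_mono ?_ ?_) _
        · simpa using hts ha
        · refine hCt _ hsub ?_
          rw [Finset.card_erase_of_mem ha]
          omega

theorem isCompact_convexHull_of_finiteDimensional {E : Type*} [AddCommGroup E] [Module ℝ E]
    [TopologicalSpace E] [IsTopologicalAddGroup E] [ContinuousSMul ℝ E] [FiniteDimensional ℝ E]
    {s : Set E} (hs : IsCompact s) : IsCompact (convexHull ℝ s) := by
  obtain ⟨C, hC, hCs, hCt⟩ :=
    exists_isCompact_between_convexHull hs (Module.finrank ℝ E + 1)
  have hEq : convexHull ℝ s = C := by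
    refine Set.Subset.antisymm ?_ hCs
    rw [convexHull_eq_union]
    simp only [Set.iUnion_subset_iff]
    intro t hts hind
    refine hCt t hts ?_
    have hcard := hind.card_le_finrank_succ
    rw [Fintype.card_coe] at hcard
    exact hcard.trans (Nat.succ_le_succ (Submodule.finrank_le _))
  exact hEq ▸ hC

/-! ### Projections: trace, rank, compactness -/

namespace IsProjn

variable {d : ℕ} {P : Matrix (Fin d) (Fin d) ℂ}

theorem trace_eq_rank_s8 (hP : IsProjn P) : P.trace = (P.rank : ℂ) := by
  have hidem : IsIdempotentElem (Matrix.toLin' P) := by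
    rw [IsIdempotentElem, Module.End.mul_eq_comp, ← Matrix.toLin'_mul, hP.2]
  rw [← Matrix.trace_toLin'_eq, (LinearMap.IsIdempotentElem.isProj_range _ hidem).trace]
  rfl

theorem rank_eq_iff (hP : IsProjn P) {n : ℕ} : P.rank = n ↔ P.trace = (n : ℂ) := by
  rw [hP.trace_eq_rank_s8, Nat.cast_inj]

theorem eq_zero_of_trace_eq_zero (hP : IsProjn P) (h : P.trace = 0) : P = 0 := by
  rw [← Matrix.trace_conjTranspose_mul_self_eq_zero_iff, hP.1.eq, hP.2, h]

theorem norm_apply_le (hP : IsProjn P) (i j : Fin d) : ‖P i j‖ ≤ 1 := by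
  have hU : (2 : ℂ) • P - 1 ∈ Matrix.unitaryGroup (Fin d) ℂ := by
    rw [Matrix.mem_unitaryGroup_iff, Matrix.star_eq_conjTranspose, Matrix.conjTranspose_sub,
      Matrix.conjTranspose_smul, hP.1.eq]
    simp only [sub_mul, mul_sub, smul_mul_assoc, mul_smul_comm, hP.2]
    simp
    module
  have h := entry_norm_bound_of_unitary hU i j
  have h1 : ‖(1 : Matrix (Fin d) (Fin d) ℂ) i j‖ ≤ 1 := by
    rw [Matrix.one_apply]; split_ifs <;> simp
  have h2 : (2 : ℂ) * P i j =
      ((2 : ℂ) • P - 1) i j + (1 : Matrix (Fin d) (Fin d) ℂ) i j := by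
    simp
  have h3 : 2 * ‖P i j‖ ≤ 1 + 1 := by
    calc 2 * ‖P i j‖ = ‖(2 : ℂ) * P i j‖ := by simp
      _ ≤ _ := by rw [h2]; exact (norm_add_le _ _).trans (add_le_add h h1)
  linarith

end IsProjn

theorem isCompact_setOf_isProjn_rank_eq (d n : ℕ) :
    IsCompact {P : Matrix (Fin d) (Fin d) ℂ | IsProjn P ∧ P.rank = n} := by
  have hbox : IsCompact (Set.univ.pi fun _ : Fin d => Set.univ.pi fun _ : Fin d =>
      Metric.closedBall (0 : ℂ) 1) :=
    isCompact_univ_pi fun _ => isCompact_univ_pi fun _ => isCompact_closedBall _ _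
  refine IsCompact.of_isClosed_subset (X := Fin d → Fin d → ℂ) hbox ?_ ?_
  · have hEq : {P : Matrix (Fin d) (Fin d) ℂ | IsProjn P ∧ P.rank = n} =
        {P | Pᴴ = P} ∩ {P | P * P = P} ∩ {P | P.trace = (n : ℂ)} := by
      ext P
      exact ⟨fun h => ⟨h.1, h.1.rank_eq_iff.1 h.2⟩,
        fun h => ⟨h.1, IsProjn.rank_eq_iff h.1 |>.2 h.2⟩⟩
    have hclosed : IsClosed {P : Matrix (Fin d) (Fin d) ℂ | IsProjn P ∧ P.rank = n} := by
      rw [hEq]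
      exact ((isClosed_eq (by fun_prop) (by fun_prop)).inter
        (isClosed_eq (by fun_prop) (by fun_prop))).inter
        (isClosed_eq (by fun_prop) (by fun_prop))
    exact hclosed
  · intro P hP i _ j _
    simpa using hP.1.norm_apply_le i j

theorem isCompact_corrSet (d n₁ n₂ n₃ : ℕ) : IsCompact (corrSet d n₁ n₂ n₃) := by
  let F : Matrix (Fin d) (Fin d) ℂ × Matrix (Fin d) (Fin d) ℂ × Matrix (Fin d) (Fin d) ℂ →
      ℝ × ℝ × ℝ := fun p =>
    ((1 / (d : ℝ)) * ((p.1 * p.2.1).trace).re, (1 / (d : ℝ)) * ((p.1 * p.2.2).trace).re,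
      (1 / (d : ℝ)) * ((p.2.1 * p.2.2).trace).re)
  have hF : Continuous F := by fun_prop
  have hEq : corrSet d n₁ n₂ n₃ = F '' ({P | IsProjn P ∧ P.rank = n₁} ×ˢ
      {P | IsProjn P ∧ P.rank = n₂} ×ˢ {P | IsProjn P ∧ P.rank = n₃}) := by
    ext x
    constructor
    · rintro ⟨P₁, P₂, P₃, h₁, h₂, h₃, r₁, r₂, r₃, rfl⟩
      exact ⟨(P₁, P₂, P₃), ⟨⟨h₁, r₁⟩, ⟨h₂, r₂⟩, ⟨h₃, r₃⟩⟩, rfl⟩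
    · rintro ⟨⟨P₁, P₂, P₃⟩, ⟨⟨h₁, r₁⟩, ⟨h₂, r₂⟩, ⟨h₃, r₃⟩⟩, rfl⟩
      exact ⟨P₁, P₂, P₃, h₁, h₂, h₃, r₁, r₂, r₃, rfl⟩
  rw [hEq]
  exact ((isCompact_setOf_isProjn_rank_eq d n₁).prod ((isCompact_setOf_isProjn_rank_eq d n₂).prod
    (isCompact_setOf_isProjn_rank_eq d n₃))).image hF

/-! ### First-order optimality -/

section Variation

attribute [local instance] Matrix.linftyOpNormedRing Matrix.linftyOpNormedAlgebra

theorem hasDerivAt_re_trace_exp_conj {d : ℕ} (X P A : Matrix (Fin d) (Fin d) ℂ) :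
    HasDerivAt (fun t : ℝ =>
        ((NormedSpace.exp (t • X) * P * NormedSpace.exp (t • (-X)) * A).trace).re)
      (((X * P - P * X) * A).trace).re 0 := by
  have h1 := hasDerivAt_exp_smul_const (𝕂 := ℝ) X 0
  have h2 := hasDerivAt_exp_smul_const (𝕂 := ℝ) (-X) 0
  have h3 := ((h1.mul_const P).mul h2).mul_const A
  let L : Matrix (Fin d) (Fin d) ℂ →ₗ[ℝ] ℝ :=
    Complex.reLm ∘ₗ (Matrix.traceLinearMap (Fin d) ℝ ℂ)
  have h4 := (LinearMap.toContinuousLinearMap L).hasFDerivAt.comp_hasDerivAt (0 : ℝ) h3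
  have h5 : (X * P - P * X) * A = (NormedSpace.exp ((0 : ℝ) • X) * X * P *
      NormedSpace.exp ((0 : ℝ) • (-X)) + NormedSpace.exp ((0 : ℝ) • X) * P *
      (NormedSpace.exp ((0 : ℝ) • (-X)) * (-X))) * A := by
    simp [sub_eq_add_neg]
  rw [h5]
  exact h4

theorem IsProjn.commute_of_forall_re_trace_le {d : ℕ} {P A : Matrix (Fin d) (Fin d) ℂ}
    (hP : IsProjn P) (hA : A.IsHermitian)
    (hmax : ∀ P' : Matrix (Fin d) (Fin d) ℂ, IsProjn P' → P'.rank = P.rank →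
      ((P' * A).trace).re ≤ ((P * A).trace).re) :
    P * A = A * P := by
  set X := P * A - A * P with hX
  have hXstar : Xᴴ = -X := by
    rw [hX, Matrix.conjTranspose_sub, Matrix.conjTranspose_mul, Matrix.conjTranspose_mul,
      hP.1.eq, hA.eq, neg_sub]
  have hmul : ∀ t : ℝ, NormedSpace.exp (t • (-X)) * NormedSpace.exp (t • X) = 1 := by
    intro t
    rw [← Matrix.exp_add_of_commute]
    · simp
    · rw [smul_neg]; exact (Commute.refl _).neg_left
  have hstar : ∀ t : ℝ, (NormedSpace.exp (t • X))ᴴ = NormedSpace.exp (t • (-X)) := by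
    intro t
    rw [← Matrix.exp_conjTranspose, Matrix.conjTranspose_smul, hXstar]
    simp
  have hstar' : ∀ t : ℝ, (NormedSpace.exp (t • (-X)))ᴴ = NormedSpace.exp (t • X) := by
    intro t
    rw [← hstar, Matrix.conjTranspose_conjTranspose]
  have hloc : IsLocalMax (fun t : ℝ =>
      ((NormedSpace.exp (t • X) * P * NormedSpace.exp (t • (-X)) * A).trace).re) 0 := by
    refine Filter.Eventually.of_forall fun t => ?_
    have hproj : IsProjn (NormedSpace.exp (t • X) * P * NormedSpace.exp (t • (-X))) := by
      constructor
      · rw [Matrix.IsHermitian, Matrix.conjTranspose_mul, Matrix.conjTranspose_mul, hstar, hstar',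
          hP.1.eq, mul_assoc]
      · calc _ = NormedSpace.exp (t • X) * P *
              (NormedSpace.exp (t • (-X)) * NormedSpace.exp (t • X)) * P *
                NormedSpace.exp (t • (-X)) := by simp only [mul_assoc]
          _ = _ := by rw [hmul, mul_one, mul_assoc _ P P, hP.2]
    have hrank : (NormedSpace.exp (t • X) * P * NormedSpace.exp (t • (-X))).rank = P.rank := by
      rw [hproj.rank_eq_iff, Matrix.trace_mul_comm, ← mul_assoc, hmul, one_mul, hP.trace_eq_rank_s8]
    simpa using hmax _ hproj hrank
  have hzero := hloc.hasDerivAt_eq_zero (hasDerivAt_re_trace_exp_conj X P A)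
  have htr : ((X * P - P * X) * A).trace = -(Xᴴ * X).trace := by
    have h1 : (P * X * A).trace = (X * (A * P)).trace := by
      rw [mul_assoc, Matrix.trace_mul_comm, mul_assoc]
    rw [sub_mul, Matrix.trace_sub, h1, mul_assoc, ← Matrix.trace_sub, ← mul_sub, ← hX, hXstar]
    simp
  have hnonneg := (Matrix.posSemidef_conjTranspose_mul_self X).trace_nonneg
  have hX0 : X = 0 := by
    rw [← Matrix.trace_conjTranspose_mul_self_eq_zero_iff]
    rw [htr, Complex.neg_re, neg_eq_zero] at hzero
    rw [Complex.le_def] at hnonneg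
    exact Complex.ext hzero hnonneg.2.symm
  exact sub_eq_zero.1 hX0

end Variation

/-! ### Isometries into kernels and compressions -/

theorem Matrix.exists_isometry_mul_eq_zero {d l : ℕ} (M : Matrix (Fin d) (Fin d) ℂ)
    (h : M.rank + l ≤ d) :
    ∃ J : Matrix (Fin d) (Fin l) ℂ, Jᴴ * J = 1 ∧ M * J = 0 := by
  let T := Matrix.toEuclideanLin M
  let V := LinearMap.ker T
  have hrange : Module.finrank ℂ (LinearMap.range T) = M.rank :=
    (M.rank_eq_finrank_range_toLin (PiLp.basisFun 2 ℂ (Fin d)) (PiLp.basisFun 2 ℂ (Fin d))).symm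
  have hdim : l ≤ Module.finrank ℂ V := by
    have := LinearMap.finrank_range_add_finrank_ker T
    rw [hrange, finrank_euclideanSpace_fin] at this
    change M.rank + Module.finrank ℂ V = d at this
    omega
  let b := stdOrthonormalBasis ℂ V
  let v : Fin l → EuclideanSpace ℂ (Fin d) := fun j => (b (Fin.castLE hdim j) : V)
  have hv : Orthonormal ℂ v :=
    (b.orthonormal.comp_linearIsometry V.subtypeₗᵢ).comp _ (Fin.castLE_injective hdim)
  refine ⟨Matrix.of fun i j => v j i, ?_, ?_⟩
  · ext j k
    have := orthonormal_iff_ite.1 hv j k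
    rw [PiLp.inner_apply] at this
    simp only [Matrix.mul_apply, Matrix.conjTranspose_apply, Matrix.of_apply, Matrix.one_apply]
    rw [← this]
    simp [mul_comm]
  · ext i j
    have hj : T (v j) = 0 := (b (Fin.castLE hdim j)).2
    have := congrArg (fun w => w i) hj
    simpa [T, Matrix.toLpLin_apply, Matrix.mulVec, dotProduct, Matrix.mul_apply] using this

theorem Matrix.rank_add_le {d : ℕ} (A B : Matrix (Fin d) (Fin d) ℂ) :
    (A + B).rank ≤ A.rank + B.rank := by
  unfold Matrix.rank
  rw [Matrix.mulVecLin_add]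
  exact (Submodule.finrank_mono (LinearMap.range_add_le _ _)).trans
    (Submodule.finrank_add_le_finrank_add_finrank _ _)

theorem IsProjn.of_isometry {d l : ℕ} {J : Matrix (Fin d) (Fin l) ℂ} (hJ : Jᴴ * J = 1) :
    IsProjn (J * Jᴴ) :=
  ⟨Matrix.isHermitian_mul_conjTranspose_self J, by
    rw [← Matrix.mul_assoc, Matrix.mul_assoc J, hJ, Matrix.mul_one]⟩

theorem Matrix.trace_isometry_mul_conjTranspose {d l : ℕ} {J : Matrix (Fin d) (Fin l) ℂ}
    (hJ : Jᴴ * J = 1) : (J * Jᴴ).trace = (l : ℂ) := by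
  rw [Matrix.trace_mul_comm, hJ]; simp

theorem IsProjn.exists_isometry_onto_compl {d e r : ℕ} {Q : Matrix (Fin d) (Fin d) ℂ}
    (hQ : IsProjn Q) (hr : Q.trace = (r : ℂ)) (hd : e + r = d) :
    ∃ J : Matrix (Fin d) (Fin e) ℂ, Jᴴ * J = 1 ∧ J * Jᴴ = 1 - Q := by
  obtain ⟨J, hJ, hQJ⟩ := Q.exists_isometry_mul_eq_zero (l := e)
    (by rw [hQ.rank_eq_iff.2 hr]; omega)
  refine ⟨J, hJ, ?_⟩
  have hJJ := IsProjn.of_isometry hJ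
  have hQE : Q * (J * Jᴴ) = 0 := by rw [← Matrix.mul_assoc, hQJ, Matrix.zero_mul]
  have hEQ : J * Jᴴ * Q = 0 := by
    have := congrArg Matrix.conjTranspose hQE
    rwa [Matrix.conjTranspose_mul, hQ.1.eq, hJJ.1.eq, Matrix.conjTranspose_zero] at this
  have hE : IsProjn (1 - Q - J * Jᴴ) := by
    refine ⟨(Matrix.isHermitian_one.sub hQ.1).sub hJJ.1, ?_⟩
    simp only [Matrix.mul_sub, Matrix.sub_mul, hQ.2, hJJ.2, hQE, hEQ]
    simp
  refine (sub_eq_zero.1 (hE.eq_zero_of_trace_eq_zero ?_)).symm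
  rw [Matrix.trace_sub, Matrix.trace_sub, Matrix.trace_isometry_mul_conjTranspose hJ, hr,
    Matrix.trace_one, Fintype.card_fin, ← hd]
  push_cast
  ring

section Compression

variable {d e : ℕ} {P P' Q : Matrix (Fin d) (Fin d) ℂ} {J : Matrix (Fin d) (Fin e) ℂ}

theorem IsProjn.compression (hP : IsProjn P) (hJ : Jᴴ * J = 1) (hJQ : J * Jᴴ = 1 - Q)
    (hPQ : P * Q = Q * P) : IsProjn (Jᴴ * P * J) := by
  have hQJ : Q * J = 0 := by
    have h : J * Jᴴ * J = J - Q * J := by rw [hJQ, Matrix.sub_mul, Matrix.one_mul]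
    rw [Matrix.mul_assoc, hJ, Matrix.mul_one] at h
    exact sub_eq_self.1 h.symm
  constructor
  · rw [Matrix.IsHermitian, Matrix.conjTranspose_mul, Matrix.conjTranspose_mul,
      Matrix.conjTranspose_conjTranspose, hP.1.eq, Matrix.mul_assoc]
  · calc Jᴴ * P * J * (Jᴴ * P * J) = Jᴴ * P * (J * Jᴴ) * P * J := by simp only [Matrix.mul_assoc]
      _ = Jᴴ * (P * P) * J - Jᴴ * P * (Q * P) * J := by
        rw [hJQ, Matrix.mul_sub, Matrix.sub_mul, Matrix.sub_mul]
        simp only [Matrix.mul_assoc, Matrix.one_mul]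
      _ = Jᴴ * P * J := by
        rw [← hPQ, hP.2, ← Matrix.mul_assoc, Matrix.mul_assoc _ Q J, hQJ,
          Matrix.mul_zero, sub_zero]

theorem Matrix.trace_compression (hJQ : J * Jᴴ = 1 - Q) (A : Matrix (Fin d) (Fin d) ℂ) :
    (Jᴴ * A * J).trace = A.trace - (A * Q).trace := by
  rw [Matrix.mul_assoc, Matrix.trace_mul_comm, Matrix.mul_assoc, hJQ, Matrix.mul_sub,
    Matrix.mul_one, Matrix.trace_sub]

theorem Matrix.trace_compression_mul (hJQ : J * Jᴴ = 1 - Q) (hPQ : P' * Q = Q * P')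
    (hQ : Q * Q = Q) :
    ((Jᴴ * P * J) * (Jᴴ * P' * J)).trace = (P * P').trace - (P * (P' * Q)).trace := by
  have h : (Jᴴ * P * J) * (Jᴴ * P' * J) = Jᴴ * (P * (J * Jᴴ) * P') * J := by
    simp only [Matrix.mul_assoc]
  rw [h, Matrix.trace_compression hJQ, hJQ, Matrix.mul_sub, Matrix.mul_one, Matrix.sub_mul,
    Matrix.sub_mul, Matrix.trace_sub,
    Matrix.trace_sub]
  have h1 : P * Q * P' = P * (P' * Q) := by rw [Matrix.mul_assoc, hPQ]
  rw [h1]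
  have h2 : P * (P' * Q) * Q = P * (P' * Q) := by rw [Matrix.mul_assoc, Matrix.mul_assoc, hQ]
  rw [h2, Matrix.mul_assoc]
  ring

end Compression

theorem mem_smul_corrSet_of_reducing {d e r n₁ n₂ n₃ k₁ k₂ k₃ N₁ N₂ N₃ : ℕ}
    {P₁ P₂ P₃ Q Q₁ Q₂ Q₃ : Matrix (Fin d) (Fin d) ℂ}
    (h₁ : IsProjn P₁) (h₂ : IsProjn P₂) (h₃ : IsProjn P₃) (hQ : IsProjn Q)
    (r₁ : P₁.rank = n₁) (r₂ : P₂.rank = n₂) (r₃ : P₃.rank = n₃)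
    (hQ₁ : P₁ * Q = Q₁) (hQ₂ : P₂ * Q = Q₂) (hQ₃ : P₃ * Q = Q₃)
    (s₁ : Q₁.IsHermitian) (s₂ : Q₂.IsHermitian) (s₃ : Q₃.IsHermitian)
    (h12 : P₁ * Q₂ = 0) (h13 : P₁ * Q₃ = 0) (h23 : P₂ * Q₃ = 0)
    (t : Q.trace = (r : ℂ)) (t₁ : Q₁.trace = (k₁ : ℂ)) (t₂ : Q₂.trace = (k₂ : ℂ))
    (t₃ : Q₃.trace = (k₃ : ℂ)) (hd : e + r = d) (he : 0 < e)
    (hN₁ : N₁ + k₁ = n₁) (hN₂ : N₂ + k₂ = n₂) (hN₃ : N₃ + k₃ = n₃) :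
    ((1 / (d : ℝ)) * ((P₁ * P₂).trace).re, (1 / (d : ℝ)) * ((P₁ * P₃).trace).re,
      (1 / (d : ℝ)) * ((P₂ * P₃).trace).re) ∈ ((e : ℝ) / d) • corrSet e N₁ N₂ N₃ := by
  have comm : ∀ {P R : Matrix (Fin d) (Fin d) ℂ}, IsProjn P → P * Q = R → R.IsHermitian →
      P * Q = Q * P := by
    intro P R hP hR hs
    rw [← hR, Matrix.IsHermitian, Matrix.conjTranspose_mul, hP.1.eq, hQ.1.eq] at hs
    exact hs.symm
  have c₁ := comm h₁ hQ₁ s₁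
  have c₂ := comm h₂ hQ₂ s₂
  have c₃ := comm h₃ hQ₃ s₃
  obtain ⟨J, hJ, hJQ⟩ := hQ.exists_isometry_onto_compl t hd
  have rank_compr : ∀ {P R : Matrix (Fin d) (Fin d) ℂ} {n k N : ℕ}, IsProjn P → P * Q = R →
      P * Q = Q * P → P.rank = n → R.trace = (k : ℂ) → N + k = n →
      (Jᴴ * P * J).rank = N := by
    intro P R n k N hP hR hc hn hk hN
    rw [(hP.compression hJ hJQ hc).rank_eq_iff, Matrix.trace_compression hJQ, hR, hk,
      hP.rank_eq_iff.1 hn, ← hN]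
    push_cast
    ring
  have tr : ∀ {P P' R : Matrix (Fin d) (Fin d) ℂ}, P' * Q = R → P' * Q = Q * P' → P * R = 0 →
      ((Jᴴ * P * J) * (Jᴴ * P' * J)).trace = (P * P').trace := by
    intro P P' R hR hc h0
    rw [Matrix.trace_compression_mul hJQ hc hQ.2, hR, h0, Matrix.trace_zero, sub_zero]
  refine Set.mem_smul_set.2 ⟨_, ⟨Jᴴ * P₁ * J, Jᴴ * P₂ * J, Jᴴ * P₃ * J,
    h₁.compression hJ hJQ c₁, h₂.compression hJ hJQ c₂, h₃.compression hJ hJQ c₃,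
    rank_compr h₁ hQ₁ c₁ r₁ t₁ hN₁, rank_compr h₂ hQ₂ c₂ r₂ t₂ hN₂,
    rank_compr h₃ hQ₃ c₃ r₃ t₃ hN₃, rfl⟩, ?_⟩
  have he' : (e : ℝ) ≠ 0 := by positivity
  have hscale : ∀ x : ℝ, (e : ℝ) / d * (1 / e * x) = 1 / d * x := by
    intro x
    field_simp
  rw [tr hQ₂ c₂ h12, tr hQ₃ c₃ h13, tr hQ₃ c₃ h23]
  simp only [Prod.smul_mk, smul_eq_mul, hscale]

/-! ### Stationary triples -/

theorem IsProjn.mul_eq_zero_of_add_mul_eq_zero {d l : ℕ} {P B : Matrix (Fin d) (Fin d) ℂ}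
    {J : Matrix (Fin d) (Fin l) ℂ} (hP : IsProjn P) (hB : B.PosSemidef)
    (h : (P + B) * J = 0) : P * J = 0 ∧ B * J = 0 := by
  have hPJ : Jᴴ * P * J = (P * J)ᴴ * (P * J) := by
    rw [Matrix.conjTranspose_mul, hP.1.eq, Matrix.mul_assoc, Matrix.mul_assoc, ← Matrix.mul_assoc P,
      hP.2]
  have hsum : (Jᴴ * P * J).trace + (Jᴴ * B * J).trace = 0 := by
    rw [← Matrix.trace_add, ← Matrix.add_mul, ← Matrix.mul_add, Matrix.mul_assoc, h,
      Matrix.mul_zero, Matrix.trace_zero]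
  have h1 : 0 ≤ (Jᴴ * P * J).trace := by
    rw [hPJ]; exact (Matrix.posSemidef_conjTranspose_mul_self _).trace_nonneg
  have h2 : 0 ≤ (Jᴴ * B * J).trace := (hB.conjTranspose_mul_mul_same J).trace_nonneg
  have h0 : P * J = 0 := by
    rw [← Matrix.trace_conjTranspose_mul_self_eq_zero_iff, ← hPJ]
    exact ((add_eq_zero_iff_of_nonneg h1 h2).1 hsum).1
  exact ⟨h0, by rwa [Matrix.add_mul, h0, zero_add] at h⟩

theorem IsProjn.posSemidef {d : ℕ} {P : Matrix (Fin d) (Fin d) ℂ} (hP : IsProjn P) :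
    P.PosSemidef := by
  have h := Matrix.posSemidef_conjTranspose_mul_self P
  rwa [hP.1.eq, hP.2] at h

theorem Matrix.mul_mul_eq_zero_of_commute {d l : ℕ} {P Q R : Matrix (Fin d) (Fin d) ℂ}
    {J : Matrix (Fin d) (Fin l) ℂ} {a c : ℝ} (ha : a ≠ 0) (h : Commute Q (a • P + c • R))
    (hQ : Q * J = 0) (hR : R * J = 0) : Q * (P * J) = 0 := by
  have h1 := congrArg (· * J) h.eq
  simp only [Matrix.mul_assoc, hQ, Matrix.mul_zero, Matrix.add_mul, Matrix.smul_mul, hR, smul_zero,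
    add_zero, Matrix.mul_smul] at h1
  exact (smul_eq_zero.1 h1).resolve_left ha

theorem IsProjn.exists_isometry_fixed_of_commute {d n l : ℕ} {P Q R : Matrix (Fin d) (Fin d) ℂ}
    (hP : IsProjn P) (hQ : IsProjn Q) (hR : IsProjn R) (rQ : Q.rank = n) (rR : R.rank = n)
    (hd : 2 * n + l ≤ d) {a b c c' : ℝ} (ha : a ≠ 0) (hb : b ≠ 0)
    (hQc : Commute Q (a • P + c • R)) (hRc : Commute R (b • P + c' • Q))
    (hker : ∀ X : Matrix (Fin d) (Fin l) ℂ, P * X = 0 → Q * X = 0 → R * X = 0 → X = 0) :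
    ∃ J : Matrix (Fin d) (Fin l) ℂ, Jᴴ * J = 1 ∧ P * J = J ∧ Q * J = 0 ∧ R * J = 0 := by
  obtain ⟨J, hJ, h0⟩ := (Q + R).exists_isometry_mul_eq_zero (l := l)
    (by have := Matrix.rank_add_le Q R; omega)
  obtain ⟨hQJ, hRJ⟩ := hQ.mul_eq_zero_of_add_mul_eq_zero hR.posSemidef h0
  refine ⟨J, hJ, ?_, hQJ, hRJ⟩
  refine (sub_eq_zero.1 (hker (J - P * J) ?_ ?_ ?_)).symm
  · rw [Matrix.mul_sub, ← Matrix.mul_assoc, hP.2, sub_self]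
  · rw [Matrix.mul_sub, hQJ, Matrix.mul_mul_eq_zero_of_commute ha hQc hQJ hRJ, sub_self]
  · rw [Matrix.mul_sub, hRJ, Matrix.mul_mul_eq_zero_of_commute hb hRc hRJ hQJ, sub_self]

theorem IsProjn.isometry_mul_isometry_eq_zero {d l : ℕ} {P : Matrix (Fin d) (Fin d) ℂ}
    {J K : Matrix (Fin d) (Fin l) ℂ} (hP : IsProjn P) (hJ : P * J = J) (hK : P * K = 0) :
    J * Jᴴ * (K * Kᴴ) = 0 := by
  have h : Jᴴ * K = 0 := by
    rw [← hJ, Matrix.conjTranspose_mul, hP.1.eq, Matrix.mul_assoc, hK, Matrix.mul_zero]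
  rw [Matrix.mul_assoc, ← Matrix.mul_assoc Jᴴ, h, Matrix.zero_mul, Matrix.mul_zero]

theorem mem_union_of_commute {n m d l : ℕ} (hd : 2 * n + m = d) (hln : l < n) (hlm : l ≤ m)
    {P₁ P₂ P₃ : Matrix (Fin d) (Fin d) ℂ}
    (h₁ : IsProjn P₁) (h₂ : IsProjn P₂) (h₃ : IsProjn P₃)
    (r₁ : P₁.rank = n) (r₂ : P₂.rank = n) (r₃ : P₃.rank = n)
    {a b c : ℝ} (ha : a ≠ 0) (hb : b ≠ 0) (hc : c ≠ 0)
    (c₁ : Commute P₁ (a • P₂ + b • P₃)) (c₂ : Commute P₂ (a • P₁ + c • P₃))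
    (c₃ : Commute P₃ (b • P₁ + c • P₂)) :
    ((1 / (d : ℝ)) * ((P₁ * P₂).trace).re, (1 / (d : ℝ)) * ((P₁ * P₃).trace).re,
      (1 / (d : ℝ)) * ((P₂ * P₃).trace).re) ∈
      (((d - 1 : ℕ) : ℝ) / d) • corrSet (d - 1) n n n ∪
      (((d - 3 * l : ℕ) : ℝ) / d) • corrSet (d - 3 * l) (n - l) (n - l) (n - l) := by
  by_cases hrank : (P₁ + (P₂ + P₃)).rank + 1 ≤ d
  · left
    obtain ⟨J, hJ, h0⟩ := Matrix.exists_isometry_mul_eq_zero _ hrank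
    obtain ⟨hJ₁, h0⟩ := h₁.mul_eq_zero_of_add_mul_eq_zero (h₂.posSemidef.add h₃.posSemidef) h0
    obtain ⟨hJ₂, hJ₃⟩ := h₂.mul_eq_zero_of_add_mul_eq_zero h₃.posSemidef h0
    have hz : (0 : Matrix (Fin d) (Fin d) ℂ).IsHermitian := Matrix.isHermitian_zero
    refine mem_smul_corrSet_of_reducing (Q := J * Jᴴ) (Q₁ := 0) (Q₂ := 0) (Q₃ := 0)
      (r := 1) (k₁ := 0) (k₂ := 0) (k₃ := 0) h₁ h₂ h₃ (IsProjn.of_isometry hJ) r₁ r₂ r₃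
      ?_ ?_ ?_ hz hz hz (Matrix.mul_zero _) (Matrix.mul_zero _) (Matrix.mul_zero _)
      (Matrix.trace_isometry_mul_conjTranspose hJ) (by simp) (by simp) (by simp)
      (by omega) (by omega) rfl rfl rfl
    · rw [← Matrix.mul_assoc, hJ₁, Matrix.zero_mul]
    · rw [← Matrix.mul_assoc, hJ₂, Matrix.zero_mul]
    · rw [← Matrix.mul_assoc, hJ₃, Matrix.zero_mul]
  · right
    have hker : ∀ X : Matrix (Fin d) (Fin l) ℂ, P₁ * X = 0 → P₂ * X = 0 → P₃ * X = 0 → X = 0 := by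
      intro X hX₁ hX₂ hX₃
      have hX : (P₁ + (P₂ + P₃)) * X = 0 := by
        rw [Matrix.add_mul, Matrix.add_mul, hX₁, hX₂, hX₃, add_zero, add_zero]
      have hle := Matrix.rank_add_rank_le_card_of_mul_eq_zero hX
      rw [Fintype.card_fin] at hle
      have hX0 : X.rank = 0 := by omega
      rw [← Matrix.toLin'.map_eq_zero_iff, ← LinearMap.range_eq_bot]
      exact Submodule.finrank_eq_zero.1 hX0
    have hdl : 2 * n + l ≤ d := by omega
    obtain ⟨J₁, i₁, f11, f21, f31⟩ :=
      h₁.exists_isometry_fixed_of_commute h₂ h₃ r₂ r₃ hdl ha hb c₂ c₃ hker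
    obtain ⟨J₂, i₂, f22, f12, f32⟩ :=
      h₂.exists_isometry_fixed_of_commute h₁ h₃ r₁ r₃ hdl ha hc c₁ (by rwa [add_comm])
        fun X h h' => hker X h' h
    obtain ⟨J₃, i₃, f33, f13, f23⟩ :=
      h₃.exists_isometry_fixed_of_commute h₁ h₂ r₁ r₂ hdl hb hc (by rwa [add_comm])
        (by rwa [add_comm]) fun X h h' h'' => hker X h' h'' h
    have fixes : ∀ {P : Matrix (Fin d) (Fin d) ℂ} {J : Matrix (Fin d) (Fin l) ℂ},
        P * J = J → P * (J * Jᴴ) = J * Jᴴ := by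
      intro P J h
      rw [← Matrix.mul_assoc, h]
    have kills : ∀ {P : Matrix (Fin d) (Fin d) ℂ} {J : Matrix (Fin d) (Fin l) ℂ},
        P * J = 0 → P * (J * Jᴴ) = 0 := by
      intro P J h
      rw [← Matrix.mul_assoc, h, Matrix.zero_mul]
    have q₁ := IsProjn.of_isometry i₁
    have q₂ := IsProjn.of_isometry i₂
    have q₃ := IsProjn.of_isometry i₃
    have t₁ := Matrix.trace_isometry_mul_conjTranspose i₁
    have t₂ := Matrix.trace_isometry_mul_conjTranspose i₂
    have t₃ := Matrix.trace_isometry_mul_conjTranspose i₃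
    have hQ : IsProjn (J₁ * J₁ᴴ + J₂ * J₂ᴴ + J₃ * J₃ᴴ) := by
      refine ⟨(q₁.1.add q₂.1).add q₃.1, ?_⟩
      simp only [Matrix.mul_add, Matrix.add_mul, q₁.2, q₂.2, q₃.2,
        h₁.isometry_mul_isometry_eq_zero f11 f12, h₁.isometry_mul_isometry_eq_zero f11 f13,
        h₂.isometry_mul_isometry_eq_zero f22 f21, h₂.isometry_mul_isometry_eq_zero f22 f23,
        h₃.isometry_mul_isometry_eq_zero f33 f31, h₃.isometry_mul_isometry_eq_zero f33 f32,
        add_zero, zero_add]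
    refine mem_smul_corrSet_of_reducing (r := 3 * l) (k₁ := l) (k₂ := l) (k₃ := l)
      h₁ h₂ h₃ hQ r₁ r₂ r₃
      (by rw [Matrix.mul_add, Matrix.mul_add, fixes f11, kills f12, kills f13, add_zero, add_zero])
      (by rw [Matrix.mul_add, Matrix.mul_add, kills f21, fixes f22, kills f23, add_zero, zero_add])
      (by rw [Matrix.mul_add, Matrix.mul_add, kills f31, kills f32, fixes f33, add_zero, zero_add])
      q₁.1 q₂.1 q₃.1 (kills f12) (kills f13) (kills f23) ?_ t₁ t₂ t₃
      (by omega) (by omega) (by omega) (by omega) (by omega)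
    rw [Matrix.trace_add, Matrix.trace_add, t₁, t₂, t₃]
    push_cast
    ring

theorem exists_mem_union_forall_le {n m d l : ℕ} (hd : 2 * n + m = d) (hln : l < n)
    (hlm : l ≤ m) {a b c : ℝ} (ha : a ≠ 0) (hb : b ≠ 0) (hc : c ≠ 0)
    {x : ℝ × ℝ × ℝ} (hx : x ∈ corrSet d n n n) :
    ∃ y ∈ (((d - 1 : ℕ) : ℝ) / d) • corrSet (d - 1) n n n ∪
      (((d - 3 * l : ℕ) : ℝ) / d) • corrSet (d - 3 * l) (n - l) (n - l) (n - l),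
      a * x.1 + b * x.2.1 + c * x.2.2 ≤ a * y.1 + b * y.2.1 + c * y.2.2 := by
  obtain ⟨y, hy, hmax⟩ := (isCompact_corrSet d n n n).exists_isMaxOn ⟨x, hx⟩
    (f := fun y : ℝ × ℝ × ℝ => a * y.1 + b * y.2.1 + c * y.2.2) (by fun_prop)
  refine ⟨y, ?_, hmax hx⟩
  obtain ⟨P₁, P₂, P₃, h₁, h₂, h₃, r₁, r₂, r₃, rfl⟩ := hy
  have hd0 : (0 : ℝ) < 1 / d := by
    have : 0 < d := by omega
    positivity
  have key : ∀ R₁ R₂ R₃ : Matrix (Fin d) (Fin d) ℂ, IsProjn R₁ → IsProjn R₂ → IsProjn R₃ →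
      R₁.rank = n → R₂.rank = n → R₃.rank = n →
      a * ((R₁ * R₂).trace).re + b * ((R₁ * R₃).trace).re + c * ((R₂ * R₃).trace).re ≤
        a * ((P₁ * P₂).trace).re + b * ((P₁ * P₃).trace).re + c * ((P₂ * P₃).trace).re := by
    intro R₁ R₂ R₃ g₁ g₂ g₃ s₁ s₂ s₃
    have h := hmax ⟨R₁, R₂, R₃, g₁, g₂, g₃, s₁, s₂, s₃, rfl⟩
    simp only [Set.mem_ofPred_eq] at h
    refine le_of_mul_le_mul_left ?_ hd0
    linarith
  have herm : ∀ {A B : Matrix (Fin d) (Fin d) ℂ} (s t : ℝ), IsProjn A → IsProjn B →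
      (s • A + t • B).IsHermitian := by
    intro A B s t hA hB
    rw [Matrix.IsHermitian, Matrix.conjTranspose_add, Matrix.conjTranspose_smul,
      Matrix.conjTranspose_smul, hA.1.eq, hB.1.eq, star_trivial, star_trivial]
  have retr : ∀ (A B C : Matrix (Fin d) (Fin d) ℂ) (s t : ℝ),
      ((A * (s • B + t • C)).trace).re = s * ((A * B).trace).re + t * ((A * C).trace).re := by
    intro A B C s t
    simp [Matrix.mul_add]
  refine mem_union_of_commute hd hln hlm h₁ h₂ h₃ r₁ r₂ r₃ ha hb hc ?_ ?_ ?_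
  · refine h₁.commute_of_forall_re_trace_le (herm a b h₂ h₃) fun R hR hr => ?_
    have := key R P₂ P₃ hR h₂ h₃ (hr.trans r₁) r₂ r₃
    rw [retr, retr]
    linarith
  · refine h₂.commute_of_forall_re_trace_le (herm a c h₁ h₃) fun R hR hr => ?_
    have := key P₁ R P₃ h₁ hR h₃ r₁ (hr.trans r₂) r₃
    rw [retr, retr, Matrix.trace_mul_comm R P₁, Matrix.trace_mul_comm P₂ P₁]
    linarith
  · refine h₃.commute_of_forall_re_trace_le (herm b c h₁ h₂) fun R hR hr => ?_
    have := key P₁ P₂ R h₁ h₂ hR r₁ r₂ (hr.trans r₃)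
    rw [retr, retr, Matrix.trace_mul_comm R P₁, Matrix.trace_mul_comm P₃ P₁,
      Matrix.trace_mul_comm R P₂, Matrix.trace_mul_comm P₃ P₂]
    linarith

/-! ### Separation by functionals with nonzero coefficients -/

theorem mem_of_forall_exists_le_of_ne_zero {K : Set (ℝ × ℝ × ℝ)} (hK : IsCompact K)
    (hconv : Convex ℝ K) {x : ℝ × ℝ × ℝ}
    (h : ∀ a b c : ℝ, a ≠ 0 → b ≠ 0 → c ≠ 0 →
      ∃ y ∈ K, a * x.1 + b * x.2.1 + c * x.2.2 ≤ a * y.1 + b * y.2.1 + c * y.2.2) :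
    x ∈ K := by
  by_contra hx
  obtain ⟨f, u, hfK, hfx⟩ := geometric_hahn_banach_closed_point hconv hK.isClosed hx
  set a := f (1, 0, 0)
  set b := f (0, 1, 0)
  set c := f (0, 0, 1)
  have hf : ∀ y : ℝ × ℝ × ℝ, f y = a * y.1 + b * y.2.1 + c * y.2.2 := by
    rintro ⟨y₁, y₂, y₃⟩
    have : ((y₁, y₂, y₃) : ℝ × ℝ × ℝ) =
        y₁ • (1, 0, 0) + y₂ • (0, 1, 0) + y₃ • (0, 0, 1) := by simp
    rw [this, map_add, map_add, map_smul, map_smul, map_smul]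
    simp [a, b, c, mul_comm]
  let δ : ℝ → ℝ := fun s => if s = 0 then 1 else 0
  have hδ : ∀ s ε : ℝ, 0 < ε → s + ε * δ s ≠ 0 := by
    intro s ε hε
    by_cases hs : s = 0
    · simp [δ, hs, hε.ne']
    · simp [δ, hs]
  let g : ℝ × ℝ × ℝ → ℝ := fun y =>
    δ a * (y.1 - x.1) + δ b * (y.2.1 - x.2.1) + δ c * (y.2.2 - x.2.2)
  obtain ⟨B, hB⟩ := hK.bddAbove_image (f := g) (by fun_prop)
  set ε := (f x - u) / (|B| + 1)
  have hε : 0 < ε := div_pos (sub_pos.2 hfx) (by positivity)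
  have hεB : ε * (|B| + 1) = f x - u := div_mul_cancel₀ _ (by positivity)
  obtain ⟨y, hyK, hy⟩ := h _ _ _ (hδ a ε hε) (hδ b ε hε) (hδ c ε hε)
  have hgy : g y ≤ |B| := (hB ⟨y, hyK, rfl⟩).trans (le_abs_self B)
  have h1 := hfK y hyK
  have h2 : f x ≤ f y + ε * g y := by
    rw [hf, hf]
    simp only [g]
    linarith
  nlinarith [mul_le_mul_of_nonneg_left hgy hε.le]

/-- Lemma 3.6 (iterated reduction for type I slices): if `2n = d − m` and
`l = min(n−1, m)`, then
`S_d(n,n,n) ⊆ co(((d−1)/d)·S_{d−1}(n,n,n) ∪ ((d−3l)/d)·S_{d−3l}(n−l,n−l,n−l))`. -/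
theorem corrSet_typeI_reduction (n m d : ℕ)
    (hn : 0 < n) (hm : 0 < m) (hd : 0 < d) (hdm : 2 * n = d - m) (hmd : m ≤ d) :
    corrSet d n n n ⊆
      convexHull ℝ
        ((((d : ℝ) - 1) / (d : ℝ)) • corrSet (d - 1) n n n ∪
          (((d : ℝ) - 3 * (min (n - 1) m : ℕ)) / (d : ℝ)) •
            corrSet (d - 3 * min (n - 1) m) (n - min (n - 1) m) (n - min (n - 1) m)
              (n - min (n - 1) m)) := by
  have hd' : 2 * n + m = d := by omega
  have hln : min (n - 1) m < n := by omega
  have hlm : min (n - 1) m ≤ m := min_le_right _ _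
  have e₁ : (d : ℝ) - 1 = ((d - 1 : ℕ) : ℝ) := by
    rw [Nat.cast_sub (by omega), Nat.cast_one]
  have e₂ : (d : ℝ) - 3 * (min (n - 1) m : ℕ) = ((d - 3 * min (n - 1) m : ℕ) : ℝ) := by
    rw [Nat.cast_sub (by omega), Nat.cast_mul, Nat.cast_ofNat]
  rw [e₁, e₂]
  intro x hx
  refine mem_of_forall_exists_le_of_ne_zero (isCompact_convexHull_of_finiteDimensional
    (((isCompact_corrSet _ _ _ _).smul _).union ((isCompact_corrSet _ _ _ _).smul _)))
    (convex_convexHull ℝ _) fun a b c ha hb hc => ?_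
  obtain ⟨y, hy, hle⟩ := exists_mem_union_forall_le hd' hln hlm ha hb hc hx
  exact ⟨y, subset_convexHull ℝ _ hy, hle⟩
end

section
/- Let n and d be positive integers with 2n ≤ d. Then: (i) (2n/d)·S₂(1) ⊆ S_d(n,n,n); (ii) if 3n ≤ d then (0,0,0) ∈ S_d(n,n,n); and (iii) if 3n > d then ((6n−2d)/d)·S₂(1) ⊆ S_d(n,n,n). -/
open Matrix
open scoped Pointwise ComplexOrder

/-- The rank of an idempotent matrix over a field is its trace. -/
theorem Matrix.trace_eq_rank_of_mul_self_eq {n K : Type*} [Fintype n] [DecidableEq n] [Field K]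
    {P : Matrix n n K} (hP : P * P = P) : P.trace = P.rank := by
  have h : IsIdempotentElem (Matrix.toLin' P) := by
    rw [IsIdempotentElem, Module.End.mul_eq_comp, ← Matrix.toLin'_mul, hP]
  rw [← Matrix.trace_toLin'_eq, (LinearMap.IsIdempotentElem.isProj_range _ h).trace]
  rfl

open scoped Kronecker in
/-- The block-diagonal matrix `(P ⊗ I) ⊕ diagonal f`, with indices relabelled along `e`. -/
def Matrix.kroneckerOneSum {a b c d : Type*} [DecidableEq b] [DecidableEq c]
    (e : d ≃ (a × b) ⊕ c) (P : Matrix a a ℂ) (f : c → ℂ) : Matrix d d ℂ :=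
  (Matrix.fromBlocks (P ⊗ₖ (1 : Matrix b b ℂ)) 0 0 (Matrix.diagonal f)).submatrix e e

theorem Matrix.IsHermitian.kroneckerOneSum {a b c d : Type*} [DecidableEq b] [DecidableEq c]
    (e : d ≃ (a × b) ⊕ c) {P : Matrix a a ℂ} {f : c → ℂ} (hP : P.IsHermitian)
    (hf : IsSelfAdjoint f) : (Matrix.kroneckerOneSum e P f).IsHermitian := by
  refine (Matrix.IsHermitian.fromBlocks ?_ (by simp) ?_).submatrix e
  · rw [Matrix.IsHermitian, Matrix.conjTranspose_kronecker, hP.eq, Matrix.conjTranspose_one]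
  · exact Matrix.isHermitian_diagonal_of_self_adjoint f hf

section KroneckerOneSum

variable {a b c d : Type*} [Fintype a] [Fintype b] [Fintype c] [Fintype d]
  [DecidableEq b] [DecidableEq c] (e : d ≃ (a × b) ⊕ c)

theorem Matrix.kroneckerOneSum_mul (P Q : Matrix a a ℂ) (f g : c → ℂ) :
    Matrix.kroneckerOneSum e P f * Matrix.kroneckerOneSum e Q g =
      Matrix.kroneckerOneSum e (P * Q) (f * g) := by
  simp only [Matrix.kroneckerOneSum, Matrix.submatrix_mul_equiv, Matrix.fromBlocks_multiply,
    ← Matrix.mul_kronecker_mul, Matrix.mul_one, Matrix.mul_zero, Matrix.zero_mul, add_zero,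
    zero_add, Matrix.diagonal_mul_diagonal]
  rfl

theorem Matrix.trace_kroneckerOneSum (P : Matrix a a ℂ) (f : c → ℂ) :
    (Matrix.kroneckerOneSum e P f).trace = Fintype.card b * P.trace + ∑ i, f i := by
  have h (M : Matrix ((a × b) ⊕ c) ((a × b) ⊕ c) ℂ) : (M.submatrix e e).trace = M.trace :=
    Equiv.sum_comp e fun i => M i i
  have h_blocks (A : Matrix (a × b) (a × b) ℂ) (D : Matrix c c ℂ) :
      (Matrix.fromBlocks A 0 0 D).trace = A.trace + D.trace := by
    simp [Matrix.trace, Fintype.sum_sum_type]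
  rw [Matrix.kroneckerOneSum, h, h_blocks, Matrix.trace_kronecker, Matrix.trace_one,
    Matrix.trace_diagonal, mul_comm]

end KroneckerOneSum

/-- The indicator function of the `i`-th of three groups of `k` indices, with `r` spare indices. -/
def groupIndicator (k r : ℕ) (i : Fin 3) : (Fin 3 × Fin k) ⊕ Fin r → ℂ :=
  Sum.elim (fun p => if p.1 = i then 1 else 0) 0

theorem isSelfAdjoint_groupIndicator (k r : ℕ) (i : Fin 3) :
    IsSelfAdjoint (groupIndicator k r i) := by
  ext (p | p) <;> simp [groupIndicator, apply_ite]

theorem groupIndicator_mul_self (k r : ℕ) (i : Fin 3) :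
    groupIndicator k r i * groupIndicator k r i = groupIndicator k r i := by
  ext (p | p) <;> simp [groupIndicator]

theorem groupIndicator_mul_of_ne (k r : ℕ) {i j : Fin 3} (hij : i ≠ j) :
    groupIndicator k r i * groupIndicator k r j = 0 := by
  ext (p | p)
  · by_cases hp : p.1 = i <;> simp [groupIndicator, hp, hij]
  · simp [groupIndicator]

theorem sum_groupIndicator (k r : ℕ) (i : Fin 3) : ∑ x, groupIndicator k r i x = k := by
  simp only [groupIndicator, Fintype.sum_sum_type, Sum.elim_inl, Sum.elim_inr, Pi.zero_apply,
    Finset.sum_const_zero, add_zero, Fintype.sum_prod_type_right, Finset.sum_ite_eq',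
    Finset.mem_univ, if_true, Finset.sum_const, Finset.card_univ, Fintype.card_fin,
    nsmul_eq_mul, mul_one]

/-- Amplifying `m`-fold and adding three mutually orthogonal projections of rank `k` scales the
correlations of three rank-one projections in dimension two by `2m / d`. -/
theorem smul_corrSet_two_subset {d m k : ℕ} (h : 2 * m + 3 * k ≤ d) :
    ((2 * (m : ℝ)) / (d : ℝ)) • corrSet 2 1 1 1 ⊆ corrSet d (m + k) (m + k) (m + k) := by
  rintro _ ⟨_, ⟨P₁, P₂, P₃, h₁, h₂, h₃, r₁, r₂, r₃, rfl⟩, rfl⟩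
  obtain ⟨r, rfl⟩ := Nat.exists_eq_add_of_le h
  let e : Fin (2 * m + 3 * k + r) ≃ (Fin 2 × Fin m) ⊕ ((Fin 3 × Fin k) ⊕ Fin r) :=
    (Fintype.equivFinOfCardEq (by simp; ring)).symm
  have proj {P : Matrix (Fin 2) (Fin 2) ℂ} (hP : IsProjn P) (i : Fin 3) :
      IsProjn (Matrix.kroneckerOneSum e P (groupIndicator k r i)) :=
    ⟨hP.1.kroneckerOneSum e (isSelfAdjoint_groupIndicator k r i), by
      rw [Matrix.kroneckerOneSum_mul, hP.2, groupIndicator_mul_self]⟩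
  have rank {P : Matrix (Fin 2) (Fin 2) ℂ} (hP : IsProjn P) (hr : P.rank = 1) (i : Fin 3) :
      (Matrix.kroneckerOneSum e P (groupIndicator k r i)).rank = m + k := by
    have ht := Matrix.trace_eq_rank_of_mul_self_eq (proj hP i).2
    rw [Matrix.trace_kroneckerOneSum, sum_groupIndicator,
      Matrix.trace_eq_rank_of_mul_self_eq hP.2, hr, Fintype.card_fin] at ht
    rw [Nat.cast_one, mul_one] at ht
    exact_mod_cast ht.symm
  have corr (P Q : Matrix (Fin 2) (Fin 2) ℂ) {i j : Fin 3} (hij : i ≠ j) :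
      (Matrix.kroneckerOneSum e P (groupIndicator k r i) *
        Matrix.kroneckerOneSum e Q (groupIndicator k r j)).trace.re = m * (P * Q).trace.re := by
    simp [Matrix.kroneckerOneSum_mul, Matrix.trace_kroneckerOneSum,
      groupIndicator_mul_of_ne k r hij]
  refine ⟨_, _, _, proj h₁ 0, proj h₂ 1, proj h₃ 2, rank h₁ r₁ 0, rank h₂ r₂ 1, rank h₃ r₃ 2, ?_⟩
  rw [corr _ _ (by decide), corr _ _ (by decide), corr _ _ (by decide)]
  simp only [Prod.smul_mk, smul_eq_mul, Prod.mk.injEq]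
  refine ⟨?_, ?_, ?_⟩ <;> push_cast <;> ring

theorem corrSet_two_one_nonempty : (corrSet 2 1 1 1).Nonempty := by
  have hP : IsProjn (Matrix.diagonal ![1, 0] : Matrix (Fin 2) (Fin 2) ℂ) := by
    constructor
    · refine Matrix.isHermitian_diagonal_of_self_adjoint _ ?_
      ext i
      fin_cases i <;> simp
    · rw [Matrix.diagonal_mul_diagonal]
      congr 1
      ext i
      fin_cases i <;> simp
  have hr : (Matrix.diagonal ![1, 0] : Matrix (Fin 2) (Fin 2) ℂ).rank = 1 := by
    have ht := Matrix.trace_eq_rank_of_mul_self_eq hP.2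
    simp only [Matrix.trace_diagonal, Fin.sum_univ_two, Matrix.cons_val_zero,
      Matrix.cons_val_one, add_zero] at ht
    exact_mod_cast ht.symm
  exact ⟨_, _, _, _, hP, hP, hP, hr, hr, hr, rfl⟩

/-- Remark 3.8 (reverse inclusions for type I slices): if `2n ≤ d` then
`(2n/d)·S₂(1) ⊆ S_d(n,n,n)`; `(0,0,0) ∈ S_d(n,n,n)` when `3n ≤ d`; and
`((6n−2d)/d)·S₂(1) ⊆ S_d(n,n,n)` when `3n > d`. -/
theorem corrSet_typeI_reverse (n d : ℕ) (hn : 0 < n) (hd : 0 < d) (h : 2 * n ≤ d) :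
    ((2 * (n : ℝ)) / (d : ℝ)) • corrSet 2 1 1 1 ⊆ corrSet d n n n ∧
    (3 * n ≤ d → ((0 : ℝ), (0 : ℝ), (0 : ℝ)) ∈ corrSet d n n n) ∧
    (d < 3 * n →
      ((6 * (n : ℝ) - 2 * (d : ℝ)) / (d : ℝ)) • corrSet 2 1 1 1 ⊆ corrSet d n n n) := by
  refine ⟨smul_corrSet_two_subset (k := 0) (by omega), fun h3 => ?_, fun h3 => ?_⟩
  · obtain ⟨x, hx⟩ := corrSet_two_one_nonempty
    have hmem := smul_corrSet_two_subset (m := 0) (k := n) (by omega : 2 * 0 + 3 * n ≤ d)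
      (Set.smul_mem_smul_set hx)
    rw [zero_add] at hmem
    simpa [← Prod.zero_eq_mk] using hmem
  · obtain ⟨m, hm⟩ := Nat.exists_eq_add_of_le h3.le
    obtain ⟨k, rfl⟩ := Nat.exists_eq_add_of_le h
    obtain rfl : n = m + k := by omega
    have hsub := smul_corrSet_two_subset (by omega : 2 * m + 3 * k ≤ 2 * (m + k) + k)
    convert hsub using 3
    push_cast
    ring
end

section
/- Let n and d be positive integers with 2n ≤ d. Then S_d(n, d−n, d−n) ⊆ co{ max(0,(6n−2d)/d)·S₂(1) + {a}, (2n/d)·S₂(1) + {b} }, where a = (min(n, d−2n)/d, min(n, d−2n)/d, (d−2n)/d) and b = (0, 0, (d−2n)/d). -/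
open Matrix
open scoped Pointwise ComplexOrder

section Geometry
open scoped InnerProductSpace
open Module

variable {E : Type*} [NormedAddCommGroup E] [InnerProductSpace ℂ E] [FiniteDimensional ℂ E]

/-- A pairwise orthogonal family indexed by a set of the size of the dimension consists of
nonnegative multiples of the vectors of an orthonormal basis. -/
theorem exists_orthonormalBasis_norm_smul {ι : Type*} [Fintype ι]
    (hι : finrank ℂ E = Fintype.card ι) (w : ι → E) (hw : ∀ i j, i ≠ j → ⟪w i, w j⟫_ℂ = 0) :
    ∃ b : OrthonormalBasis ι ℂ E, ∀ i, w i = ((‖w i‖ : ℝ) : ℂ) • b i := by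
  have hv : Orthonormal ℂ
      (Set.domRestrict {i | w i ≠ 0} (fun i => (((‖w i‖⁻¹ : ℝ)) : ℂ) • w i)) := by
    constructor
    · rintro ⟨i, hi⟩
      have : ‖w i‖ ≠ 0 := norm_ne_zero_iff.2 hi
      simp [Set.domRestrict, norm_smul, this]
    · rintro ⟨i, hi⟩ ⟨j, hj⟩ hij
      have hij' : i ≠ j := fun h => hij (Subtype.ext h)
      simp [Set.domRestrict, inner_smul_left, inner_smul_right, hw i j hij']
  obtain ⟨b, hb⟩ := hv.exists_orthonormalBasis_extension_of_card_eq hι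
  refine ⟨b, fun i => ?_⟩
  by_cases hi : w i = 0
  · simp [hi]
  · rw [hb i hi, smul_smul, ← Complex.ofReal_mul, mul_inv_cancel₀ (norm_ne_zero_iff.2 hi)]
    simp

/-- Principal vectors of a pair of subspaces of equal dimension. -/
theorem exists_principal_vectors (U V : Submodule ℂ E) {n : ℕ} (hU : finrank ℂ U = n)
    (hV : finrank ℂ V = n) :
    ∃ (e : OrthonormalBasis (Fin n) ℂ U) (f : OrthonormalBasis (Fin n) ℂ V) (c : Fin n → ℝ),
      (∀ k, 0 ≤ c k) ∧ ∀ k, V.starProjection (e k : E) = (c k : ℂ) • (f k : E) := by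
  let S : U →ₗ[ℂ] U :=
    (U.orthogonalProjectionOnto : E →ₗ[ℂ] U) ∘ₗ (V.starProjection : E →ₗ[ℂ] E) ∘ₗ U.subtype
  have hS : ∀ x y : U,
      ⟪x, S y⟫_ℂ = ⟪V.orthogonalProjectionOnto x, V.orthogonalProjectionOnto y⟫_ℂ := by
    intro x y
    change ⟪(x : E), U.starProjection (V.starProjection y)⟫_ℂ = _
    rw [← Submodule.inner_starProjection_left_eq_right,
      Submodule.starProjection_eq_self_iff.2 x.2,
      ← Submodule.starProjection_eq_self_iff.2 (V.starProjection_apply_mem (y : E)),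
      ← Submodule.inner_starProjection_left_eq_right]
    rfl
  have hsym : S.IsSymmetric := by
    intro x y
    rw [hS, ← inner_conj_symm, hS, inner_conj_symm]
  let e := hsym.eigenvectorBasis hU
  obtain ⟨f, hf⟩ := exists_orthonormalBasis_norm_smul (ι := Fin n) (by simpa using hV)
    (fun k => V.orthogonalProjectionOnto (e k : E)) (by
      intro i j hij
      rw [← hS, hsym.apply_eigenvectorBasis, inner_smul_right, e.orthonormal.2 hij, mul_zero])
  refine ⟨e, f, fun k => ‖V.orthogonalProjectionOnto (e k : E)‖, fun k => norm_nonneg _,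
    fun k => ?_⟩
  rw [Submodule.starProjection_apply]
  exact congrArg (Subtype.val) (hf k)

theorem trace_comp_starProjection (T : E →ₗ[ℂ] E) (U : Submodule ℂ E) {n : ℕ}
    (e : OrthonormalBasis (Fin n) ℂ U) :
    LinearMap.trace ℂ E (T ∘ₗ (U.starProjection : E →ₗ[ℂ] E)) = ∑ k, ⟪(e k : E), T (e k)⟫_ℂ := by
  have h : T ∘ₗ (U.starProjection : E →ₗ[ℂ] E) =
      (T ∘ₗ U.subtype) ∘ₗ (U.orthogonalProjectionOnto : E →ₗ[ℂ] U) := by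
    rfl
  rw [h, LinearMap.trace_comp_comm', LinearMap.trace_eq_sum_inner _ e]
  simp

theorem trace_starProjection (W : Submodule ℂ E) :
    LinearMap.trace ℂ E (W.starProjection : E →ₗ[ℂ] E) = finrank ℂ W := by
  have h : (W.starProjection : E →ₗ[ℂ] E) =
      (W.starProjection : E →ₗ[ℂ] E) ∘ₗ (W.starProjection : E →ₗ[ℂ] E) := by
    ext x
    exact (Submodule.starProjection_eq_self_iff.2 (W.starProjection_apply_mem x)).symm
  rw [h, trace_comp_starProjection _ W (stdOrthonormalBasis ℂ W),
    Finset.sum_congr rfl (g := fun _ => (1 : ℂ))]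
  · simp
  · intro k _
    change ⟪_, W.starProjection _⟫_ℂ = 1
    rw [Submodule.starProjection_eq_self_iff.2 (Subtype.coe_prop _), ← Submodule.coe_inner]
    simp

theorem inner_starProjection_eq (W : Submodule ℂ E) (x y : E) :
    ⟪x, W.starProjection y⟫_ℂ = ⟪W.starProjection x, W.starProjection y⟫_ℂ := by
  rw [Submodule.inner_starProjection_left_eq_right,
    Submodule.starProjection_eq_self_iff.2 (W.starProjection_apply_mem y)]

theorem re_inner_starProjection_self (W : Submodule ℂ E) (x : E) :
    (⟪x, W.starProjection x⟫_ℂ).re = ‖W.starProjection x‖ ^ 2 := by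
  rw [inner_starProjection_eq]
  exact inner_self_eq_norm_sq (𝕜 := ℂ) _

theorem norm_sub_starProjection_sq (W : Submodule ℂ E) (x : E) :
    ‖x - W.starProjection x‖ ^ 2 = ‖x‖ ^ 2 - ‖W.starProjection x‖ ^ 2 := by
  have h := re_inner_starProjection_self W x
  rw [@norm_sub_sq ℂ]
  simp only [RCLike.re_to_complex, h]
  ring

/-- Compression of a projection to the planes spanned by principal vectors of `U` and `V`. -/
theorem exists_plane_compressions (U V W : Submodule ℂ E) {n : ℕ} (hU : finrank ℂ U = n)
    (hV : finrank ℂ V = n) (hW : finrank ℂ W = n) (hn : 2 * n ≤ finrank ℂ E) :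
    ∃ (p s q c r : Fin n → ℝ) (ζ : ℝ),
      (LinearMap.trace ℂ E ((W.starProjection : E →ₗ[ℂ] E) ∘ₗ (U.starProjection : E →ₗ[ℂ] E))).re
        = ∑ k, p k ∧
      (LinearMap.trace ℂ E ((W.starProjection : E →ₗ[ℂ] E) ∘ₗ (V.starProjection : E →ₗ[ℂ] E))).re
        = ∑ k, (c k ^ 2 * p k + r k ^ 2 * s k + 2 * c k * r k * q k) ∧
      (LinearMap.trace ℂ E ((V.starProjection : E →ₗ[ℂ] E) ∘ₗ (U.starProjection : E →ₗ[ℂ] E))).re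
        = ∑ k, c k ^ 2 ∧
      ∑ k, (p k + s k) + ζ = n ∧ 0 ≤ ζ ∧ ζ ≤ finrank ℂ E - 2 * n ∧
      ∀ k, c k ^ 2 + r k ^ 2 = 1 ∧ 0 ≤ p k ∧ p k ≤ 1 ∧ 0 ≤ s k ∧ s k ≤ 1 ∧
        q k ^ 2 ≤ p k * s k ∧ q k ^ 2 ≤ (1 - p k) * (1 - s k) := by
  obtain ⟨e, f, c, hc, hef⟩ := exists_principal_vectors U V hU hV
  have hee : ∀ i j, ⟪(e i : E), (e j : E)⟫_ℂ = if i = j then 1 else 0 := fun i j => by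
    rw [← Submodule.coe_inner]; exact orthonormal_iff_ite.1 e.orthonormal i j
  have hff : ∀ i j, ⟪(f i : E), (f j : E)⟫_ℂ = if i = j then 1 else 0 := fun i j => by
    rw [← Submodule.coe_inner]; exact orthonormal_iff_ite.1 f.orthonormal i j
  have hfe : ∀ i j, ⟪(f i : E), (e j : E)⟫_ℂ = if i = j then (c i : ℂ) else 0 := fun i j => by
    have h : V.starProjection (f i : E) = f i := Submodule.starProjection_eq_self_iff.2 (f i).2
    have h2 := Submodule.inner_starProjection_left_eq_right V (f i : E) (e j)
    rw [h] at h2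
    rw [h2, hef, inner_smul_right, hff]
    by_cases hij : i = j <;> simp [hij]
  have hef' : ∀ i j, ⟪(e i : E), (f j : E)⟫_ℂ = if i = j then (c i : ℂ) else 0 := fun i j => by
    rw [← inner_conj_symm, hfe]
    by_cases hij : i = j
    · simp [hij]
    · simp [hij, Ne.symm hij]
  let w : Fin n ⊕ Fin n ⊕ Fin (finrank ℂ E - 2 * n) → E :=
    Sum.elim (fun k => (e k : E)) (Sum.elim (fun k => (f k : E) - (c k : ℂ) • (e k : E)) 0)
  obtain ⟨b, hb⟩ := exists_orthonormalBasis_norm_smul (E := E) (by simp; omega) w (by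
    rintro (i | i | i) (j | j | j) hij
    all_goals simp [w, inner_sub_left, inner_sub_right, inner_smul_left, inner_smul_right,
      hee, hff, hfe, hef']
    · exact fun h => hij (congrArg _ h)
    all_goals by_cases h : i = j <;> simp_all)
  have hbe : ∀ k, b (Sum.inl k) = e k := fun k => by
    have h := hb (Sum.inl k)
    have : ‖(e k : E)‖ = 1 := e.orthonormal.1 k
    simpa [w, this] using h.symm
  let g : Fin n → E := fun k => b (Sum.inr (Sum.inl k))
  let r : Fin n → ℝ := fun k => ‖(f k : E) - (c k : ℂ) • (e k : E)‖
  have hfg : ∀ k, (f k : E) = (c k : ℂ) • (e k : E) + (r k : ℂ) • g k := fun k => by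
    have h := hb (Sum.inr (Sum.inl k))
    simp only [w, Sum.elim_inr, Sum.elim_inl] at h
    change _ = _ + ((‖(f k : E) - (c k : ℂ) • (e k : E)‖ : ℝ) : ℂ) • b (Sum.inr (Sum.inl k))
    rw [← h]; abel
  have hcr : ∀ k, c k ^ 2 + r k ^ 2 = 1 := fun k => by
    have h : ((r k ^ 2 : ℝ) : ℂ) = 1 - c k ^ 2 := by
      push_cast
      have h := inner_self_eq_norm_sq_to_K (𝕜 := ℂ) ((f k : E) - (c k : ℂ) • (e k : E))
      refine h.symm.trans ?_
      rw [inner_sub_left, inner_sub_right, inner_sub_right]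
      simp only [inner_smul_left, inner_smul_right, hee, hff, hfe, hef', if_true,
        Complex.conj_ofReal]
      ring
    have h' : r k ^ 2 = 1 - c k ^ 2 := by exact_mod_cast h
    linarith
  have hbn : ∀ i, ‖b i‖ = 1 := fun i => b.orthonormal.1 i
  have hen : ∀ k, ‖(e k : E)‖ = 1 := fun k => by rw [← hbe]; exact hbn _
  have hgn : ∀ k, ‖g k‖ = 1 := fun k => hbn _
  have heg : ∀ k, ⟪(e k : E), g k⟫_ℂ = 0 := fun k => by
    rw [← hbe]; exact b.orthonormal.2 (by simp)
  have hle : ∀ x, ‖x‖ = 1 → ‖W.starProjection x‖ ^ 2 ≤ 1 := fun x hx => by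
    have := norm_sub_starProjection_sq W x
    rw [hx] at this
    nlinarith [sq_nonneg ‖x - W.starProjection x‖]
  refine ⟨fun k => ‖W.starProjection (e k)‖ ^ 2, fun k => ‖W.starProjection (g k)‖ ^ 2,
    fun k => (⟪W.starProjection (e k), W.starProjection (g k)⟫_ℂ).re, c, r,
    ∑ j, ‖W.starProjection (b (Sum.inr (Sum.inr j)))‖ ^ 2, ?_, ?_, ?_, ?_, ?_, ?_, ?_⟩
  · rw [trace_comp_starProjection _ U e, Complex.re_sum]
    exact Finset.sum_congr rfl fun k _ => re_inner_starProjection_self W _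
  · rw [trace_comp_starProjection _ V f, Complex.re_sum]
    refine Finset.sum_congr rfl fun k _ => (re_inner_starProjection_self W _).trans ?_
    rw [hfg k, map_add, map_smul, map_smul, @norm_add_sq ℂ]
    simp only [norm_smul, inner_smul_left, inner_smul_right]
    simp [mul_pow]
    ring
  · rw [trace_comp_starProjection _ U e, Complex.re_sum]
    refine Finset.sum_congr rfl fun k _ => (re_inner_starProjection_self V _).trans ?_
    have : ‖(f k : E)‖ = 1 := f.orthonormal.1 k
    rw [hef, norm_smul, this]
    simp
  · have ht := trace_starProjection W
    rw [hW, LinearMap.trace_eq_sum_inner _ b] at ht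
    have ht' := congrArg Complex.re ht
    rw [Complex.re_sum] at ht'
    replace ht' := (Finset.sum_congr rfl fun i _ =>
      (re_inner_starProjection_self W (b i)).symm).trans ht'
    rw [Fintype.sum_sum_type, Fintype.sum_sum_type] at ht'
    simp only [hbe, Complex.natCast_re] at ht'
    rw [← ht', Finset.sum_add_distrib, add_assoc]
  · positivity
  · refine (Finset.sum_le_sum fun j _ => hle _ (hbn _)).trans ?_
    simp [Nat.cast_sub hn]
  · intro k
    have h1 := norm_sub_starProjection_sq W (e k)
    have h2 := norm_sub_starProjection_sq W (g k)
    rw [hen] at h1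
    rw [hgn] at h2
    refine ⟨hcr k, by positivity, hle _ (hen k), by positivity, hle _ (hgn k), ?_, ?_⟩
    · rw [← mul_pow]
      refine sq_le_sq' ?_ ?_
      · exact (abs_le.1 ((Complex.abs_re_le_norm _).trans (norm_inner_le_norm _ _))).1
      · exact (abs_le.1 ((Complex.abs_re_le_norm _).trans (norm_inner_le_norm _ _))).2
    · have h3 : ⟪W.starProjection (e k), W.starProjection (g k)⟫_ℂ =
          -⟪(e k : E) - W.starProjection (e k), g k - W.starProjection (g k)⟫_ℂ := by
        have h := inner_starProjection_eq W (e k : E) (g k)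
        have h' := Submodule.inner_starProjection_left_eq_right W (e k : E) (g k)
        rw [inner_sub_left, inner_sub_right, inner_sub_right, heg, h', h]
        ring
      have h4 : (1 - ‖W.starProjection (e k)‖ ^ 2) * (1 - ‖W.starProjection (g k)‖ ^ 2) =
          (‖(e k : E) - W.starProjection (e k)‖ * ‖g k - W.starProjection (g k)‖) ^ 2 := by
        rw [mul_pow, h1, h2]; ring
      simp only [h4, h3, Complex.neg_re, neg_sq]
      refine sq_le_sq' ?_ ?_
      · exact (abs_le.1 ((Complex.abs_re_le_norm _).trans (norm_inner_le_norm _ _))).1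
      · exact (abs_le.1 ((Complex.abs_re_le_norm _).trans (norm_inner_le_norm _ _))).2

end Geometry

section Matrices
open Module

theorem IsProjn.exists_starProjection {d : ℕ} {P : Matrix (Fin d) (Fin d) ℂ} (hP : IsProjn P) :
    ∃ U : Submodule ℂ (EuclideanSpace ℂ (Fin d)),
      toEuclideanLin P = (U.starProjection : _ →ₗ[ℂ] _) ∧ finrank ℂ U = P.rank := by
  have h : (toEuclideanLin P).IsSymmetricProjection := by
    refine ⟨?_, Matrix.isSymmetric_toEuclideanLin_iff.2 hP.1⟩
    change toEuclideanLin P * toEuclideanLin P = toEuclideanLin P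
    ext1 x
    simp [toLpLin_apply, hP.2]
  obtain ⟨_, h⟩ := LinearMap.isSymmetricProjection_iff_eq_coe_starProjection_range.1 h
  refine ⟨_, h, ?_⟩
  rw [toEuclideanLin_eq_toLin_orthonormal, ← rank_eq_finrank_range_toLin]

theorem trace_toEuclideanLin {d : ℕ} (P : Matrix (Fin d) (Fin d) ℂ) :
    LinearMap.trace ℂ _ (toEuclideanLin P) = P.trace := by
  rw [toEuclideanLin_eq_toLin_orthonormal, Matrix.trace_toLin_eq]

theorem trace_mul_eq_trace_comp_toEuclideanLin {d : ℕ} (P Q : Matrix (Fin d) (Fin d) ℂ) :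
    (P * Q).trace = LinearMap.trace ℂ _ (toEuclideanLin P ∘ₗ toEuclideanLin Q) := by
  rw [← trace_toEuclideanLin]
  congr 1
  ext1 x
  simp [toLpLin_apply]

theorem IsProjn.rank_eq_trace {d : ℕ} {P : Matrix (Fin d) (Fin d) ℂ} (hP : IsProjn P) :
    (P.rank : ℂ) = P.trace := by
  obtain ⟨U, hU, hr⟩ := hP.exists_starProjection
  rw [← trace_toEuclideanLin, hU, trace_starProjection, hr]

/-- The real qubit projection with Bloch vector `(a, b)`. -/
noncomputable def blochProj (a b : ℝ) : Matrix (Fin 2) (Fin 2) ℂ :=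
  !![((1 + a) / 2 : ℂ), (b / 2 : ℂ); (b / 2 : ℂ), ((1 - a) / 2 : ℂ)]

theorem isProjn_blochProj {a b : ℝ} (h : a ^ 2 + b ^ 2 = 1) : IsProjn (blochProj a b) := by
  have h' : (a : ℂ) ^ 2 + (b : ℂ) ^ 2 = 1 := by exact_mod_cast h
  constructor
  · ext i j
    fin_cases i <;> fin_cases j <;> simp [blochProj, Matrix.conjTranspose_apply]
  · ext i j
    fin_cases i <;> fin_cases j <;> simp [blochProj, Matrix.mul_apply, Fin.sum_univ_two] <;>
      first | linear_combination (1 / 4) * h' | ring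

theorem rank_blochProj {a b : ℝ} (h : a ^ 2 + b ^ 2 = 1) : (blochProj a b).rank = 1 := by
  have h1 := (isProjn_blochProj h).rank_eq_trace
  have h2 : (blochProj a b).trace = 1 := by
    simp [blochProj, Matrix.trace, Fin.sum_univ_two]
    ring
  rw [h2] at h1
  exact_mod_cast h1

theorem re_trace_blochProj_mul (a b a' b' : ℝ) :
    ((blochProj a b * blochProj a' b').trace).re = (1 + a * a' + b * b') / 2 := by
  have : (blochProj a b * blochProj a' b').trace = (((1 + a * a' + b * b') / 2 : ℝ) : ℂ) := by
    simp [blochProj, Matrix.trace, Fin.sum_univ_two]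
    ring
  rw [this, Complex.ofReal_re]

theorem bloch_mem_corrSet {a₁ b₁ a₂ b₂ a₃ b₃ : ℝ} (h₁ : a₁ ^ 2 + b₁ ^ 2 = 1)
    (h₂ : a₂ ^ 2 + b₂ ^ 2 = 1) (h₃ : a₃ ^ 2 + b₃ ^ 2 = 1) :
    ((1 + a₁ * a₂ + b₁ * b₂) / 4, (1 + a₁ * a₃ + b₁ * b₃) / 4, (1 + a₂ * a₃ + b₂ * b₃) / 4) ∈
      corrSet 2 1 1 1 := by
  refine ⟨blochProj a₁ b₁, blochProj a₂ b₂, blochProj a₃ b₃, isProjn_blochProj h₁,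
    isProjn_blochProj h₂, isProjn_blochProj h₃, rank_blochProj h₁, rank_blochProj h₂,
    rank_blochProj h₃, ?_⟩
  simp only [re_trace_blochProj_mul, Prod.mk.injEq]
  refine ⟨?_, ?_, ?_⟩ <;> · push_cast; ring

/-- Spectral decomposition of a real `2 × 2` effect, in terms of qubit correlations. -/
theorem exists_qubit_decomposition {p s q c r : ℝ} (hcr : c ^ 2 + r ^ 2 = 1) (hp : 0 ≤ p)
    (hp' : p ≤ 1) (hs : 0 ≤ s) (hs' : s ≤ 1) (hq : q ^ 2 ≤ p * s)
    (hq' : q ^ 2 ≤ (1 - p) * (1 - s)) :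
    ∃ (l ρ : ℝ) (u : ℝ × ℝ × ℝ), 0 ≤ l ∧ 0 ≤ ρ ∧ l + ρ ≤ 1 ∧ u ∈ corrSet 2 1 1 1 ∧
      p + s = 2 * l + ρ ∧ p = l + ρ - 2 * (ρ * u.1) ∧
      c ^ 2 * p + r ^ 2 * s + 2 * c * r * q = l + ρ - 2 * (ρ * u.2.1) ∧ c ^ 2 = 2 * u.2.2 := by
  set ρ := √((p - s) ^ 2 + 4 * q ^ 2) with hρ
  have hρ0 : 0 ≤ ρ := Real.sqrt_nonneg _
  have hρ2 : ρ ^ 2 = (p - s) ^ 2 + 4 * q ^ 2 := Real.sq_sqrt (by positivity)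
  have h1 : ρ ≤ p + s := Real.sqrt_le_iff.2 ⟨by linarith, by nlinarith⟩
  have h2 : ρ ≤ 2 - p - s := Real.sqrt_le_iff.2 ⟨by linarith, by nlinarith⟩
  obtain ⟨A, B, hAB, hA, hB⟩ : ∃ A B : ℝ, A ^ 2 + B ^ 2 = 1 ∧ ρ * A = p - s ∧ ρ * B = 2 * q := by
    rcases hρ0.eq_or_lt with h0 | h0
    · rw [← h0] at hρ2
      exact ⟨1, 0, by norm_num, by nlinarith [sq_nonneg (p - s), sq_nonneg q],
        by nlinarith [sq_nonneg (p - s), sq_nonneg q]⟩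
    · refine ⟨(p - s) / ρ, 2 * q / ρ, ?_, by field_simp, by field_simp⟩
      field_simp
      linarith
  have hmem := bloch_mem_corrSet (a₁ := -A) (b₁ := -B) (a₂ := 1) (b₂ := 0)
    (a₃ := c ^ 2 - r ^ 2) (b₃ := 2 * c * r) (by linarith) (by norm_num) (by
      linear_combination (c ^ 2 + r ^ 2 + 1) * hcr)
  refine ⟨(p + s - ρ) / 2, ρ, _, by linarith, hρ0, by linarith, hmem, by ring, ?_, ?_, ?_⟩
  · linear_combination (-1 / 2 : ℝ) * hA
  · dsimp only
    linear_combination (-(c ^ 2 - r ^ 2) / 2) * hA - c * r * hB + ((p + s) / 2) * hcr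
  · dsimp only
    linear_combination (1 / 2 : ℝ) * hcr

end Matrices

section Convexity

theorem Convex.sum_smul_mem_smul {F ι : Type*} [AddCommGroup F] [Module ℝ F] {C : Set F}
    (hC : Convex ℝ C) (hne : C.Nonempty) (t : Finset ι) (w : ι → ℝ) (u : ι → F)
    (hw : ∀ i ∈ t, 0 ≤ w i) (hu : ∀ i ∈ t, u i ∈ C) :
    ∑ i ∈ t, w i • u i ∈ (∑ i ∈ t, w i) • C := by
  classical
  induction t using Finset.induction_on with
  | empty => simp [Set.zero_smul_set hne]
  | insert a t ha ih =>
    rw [Finset.sum_insert ha, Finset.sum_insert ha, hC.add_smul (hw a (by simp))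
      (Finset.sum_nonneg fun i hi => hw i (by simp [hi]))]
    exact Set.add_mem_add (Set.smul_mem_smul_set (hu a (by simp)))
      (ih (fun i hi => hw i (by simp [hi])) fun i hi => hu i (by simp [hi]))

theorem smul_add_mem_convexHull {F : Type*} [AddCommGroup F] [Module ℝ F] {S : Set F} {s : F}
    (hs : s ∈ convexHull ℝ S) (t : ℝ) (v : F) : t • s + v ∈ convexHull ℝ (t • S + {v}) := by
  rw [convexHull_add, convexHull_smul, convexHull_singleton]
  exact Set.add_mem_add (Set.smul_mem_smul_set hs) rfl

theorem half_half_half_mem_corrSet : ((1 / 2, 1 / 2, 1 / 2) : ℝ × ℝ × ℝ) ∈ corrSet 2 1 1 1 := by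
  have h := bloch_mem_corrSet (a₁ := 1) (b₁ := 0) (a₂ := 1) (b₂ := 0) (a₃ := 1) (b₃ := 0)
    (by norm_num) (by norm_num) (by norm_num)
  norm_num at h ⊢
  exact h

theorem quarter_quarter_mem_convexHull_corrSet {κ : ℝ} (h0 : 0 ≤ κ) (h1 : κ ≤ 1) :
    ((1 / 4, 1 / 4, κ / 2) : ℝ × ℝ × ℝ) ∈ convexHull ℝ (corrSet 2 1 1 1) := by
  have h := bloch_mem_corrSet (a₁ := 0) (b₁ := 1) (a₂ := 1) (b₂ := 0) (a₃ := 1) (b₃ := 0)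
    (by norm_num) (by norm_num) (by norm_num)
  have h' := bloch_mem_corrSet (a₁ := 0) (b₁ := 1) (a₂ := 1) (b₂ := 0) (a₃ := -1) (b₃ := 0)
    (by norm_num) (by norm_num) (by norm_num)
  have := convex_convexHull ℝ (corrSet 2 1 1 1) (subset_convexHull ℝ _ h)
    (subset_convexHull ℝ _ h') h0 (sub_nonneg.2 h1) (by ring)
  convert this using 1
  ext <;> simp <;> ring

/-- Scaled qubit correlations between the two extreme scales lie in the type I hull. -/
theorem mem_typeI_hull {n d : ℕ} (hd : 0 < d) (h : 2 * n ≤ d) {η : ℝ} (hη : 0 ≤ η)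
    (hηn : η ≤ n) (hηd : η ≤ (d : ℝ) - 2 * n) {s : ℝ × ℝ × ℝ}
    (hs : s ∈ convexHull ℝ (corrSet 2 1 1 1)) :
    (1 / (d : ℝ)) • ((2 * (n : ℝ) - 2 * η) • s + (η, η, (d : ℝ) - 2 * n)) ∈
      convexHull ℝ
        (((max 0 ((6 * (n : ℝ) - 2 * (d : ℝ)) / (d : ℝ))) • corrSet 2 1 1 1 +
            {(((min n (d - 2 * n) : ℕ) : ℝ) / (d : ℝ),
              ((min n (d - 2 * n) : ℕ) : ℝ) / (d : ℝ),
              (((d - 2 * n : ℕ) : ℝ)) / (d : ℝ))}) ∪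
          (((2 * (n : ℝ)) / (d : ℝ)) • corrSet 2 1 1 1 +
            {((0 : ℝ), (0 : ℝ), (((d - 2 * n : ℕ) : ℝ)) / (d : ℝ))})) := by
  have hd' : (0 : ℝ) < d := by exact_mod_cast hd
  have hcast : ((d - 2 * n : ℕ) : ℝ) = (d : ℝ) - 2 * n := by push_cast [Nat.cast_sub h]; ring
  obtain ⟨m, hm⟩ : ∃ m : ℝ, ((min n (d - 2 * n) : ℕ) : ℝ) = m := ⟨_, rfl⟩
  have hm' : m = min (n : ℝ) ((d : ℝ) - 2 * n) := by rw [← hm, Nat.cast_min, hcast]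
  have hmax : max 0 ((6 * (n : ℝ) - 2 * (d : ℝ)) / (d : ℝ)) = 2 * (n - m) / d := by
    rw [hm']
    rcases le_total (n : ℝ) ((d : ℝ) - 2 * n) with hle | hle
    · rw [min_eq_left hle, max_eq_left (div_nonpos_of_nonpos_of_nonneg (by linarith) hd'.le)]
      simp
    · rw [min_eq_right hle, max_eq_right (div_nonneg (by linarith) hd'.le)]
      congr 1; ring
  have hηm : η ≤ m := hm' ▸ le_min hηn hηd
  rw [hmax, hm, hcast]
  have hA := convexHull_mono Set.subset_union_left (smul_add_mem_convexHull hs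
    (2 * (n - m) / d) (m / (d : ℝ), m / (d : ℝ), ((d : ℝ) - 2 * n) / d)) (t :=
      ((2 * (n - m) / d) • corrSet 2 1 1 1 + {(m / (d : ℝ), m / (d : ℝ), ((d : ℝ) - 2 * n) / d)}) ∪
        ((2 * (n : ℝ) / d) • corrSet 2 1 1 1 + {((0 : ℝ), (0 : ℝ), ((d : ℝ) - 2 * n) / d)}))
  have hB := convexHull_mono Set.subset_union_right (smul_add_mem_convexHull hs
    (2 * (n : ℝ) / d) ((0 : ℝ), (0 : ℝ), ((d : ℝ) - 2 * n) / d)) (t :=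
      ((2 * (n - m) / d) • corrSet 2 1 1 1 + {(m / (d : ℝ), m / (d : ℝ), ((d : ℝ) - 2 * n) / d)}) ∪
        ((2 * (n : ℝ) / d) • corrSet 2 1 1 1 + {((0 : ℝ), (0 : ℝ), ((d : ℝ) - 2 * n) / d)}))
  obtain ⟨t, ht0, ht1, htm⟩ : ∃ t : ℝ, 0 ≤ t ∧ t ≤ 1 ∧ t * m = η := by
    rcases (hη.trans hηm).eq_or_lt with h0 | h0
    · exact ⟨0, le_rfl, zero_le_one, by linarith⟩
    · exact ⟨η / m, by positivity, (div_le_one h0).2 hηm, by field_simp⟩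
  convert convex_convexHull ℝ _ hA hB ht0 (sub_nonneg.2 ht1) (by ring) using 1
  rw [← htm]
  ext <;> simp <;> field_simp <;> ring

end Convexity

/-- Lemma 3.9 (type I slices with outcomes of experiments 2 and 3 reversed): if
`2n ≤ d`, then `S_d(n, d−n, d−n)` lies in the convex hull of
`max(0,(6n−2d)/d)·S₂(1) + {a}` and `(2n/d)·S₂(1) + {b}`. -/
theorem corrSet_typeI_swapped (n d : ℕ) (hn : 0 < n) (hd : 0 < d) (h : 2 * n ≤ d) :
    corrSet d n (d - n) (d - n) ⊆
      convexHull ℝ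
        (((max 0 ((6 * (n : ℝ) - 2 * (d : ℝ)) / (d : ℝ))) • corrSet 2 1 1 1 +
            {(((min n (d - 2 * n) : ℕ) : ℝ) / (d : ℝ),
              ((min n (d - 2 * n) : ℕ) : ℝ) / (d : ℝ),
              (((d - 2 * n : ℕ) : ℝ)) / (d : ℝ))}) ∪
          (((2 * (n : ℝ)) / (d : ℝ)) • corrSet 2 1 1 1 +
            {((0 : ℝ), (0 : ℝ), (((d - 2 * n : ℕ) : ℝ)) / (d : ℝ))})) := by
  rintro x ⟨P₁, P₂, P₃, h₁, h₂, h₃, hr₁, hr₂, hr₃, rfl⟩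
  obtain ⟨W, hW, hWr⟩ := h₁.exists_starProjection
  obtain ⟨U, hU, hUr⟩ := h₂.exists_starProjection
  obtain ⟨V, hV, hVr⟩ := h₃.exists_starProjection
  rw [hr₁] at hWr
  rw [hr₂] at hUr
  rw [hr₃] at hVr
  have hE : Module.finrank ℂ (EuclideanSpace ℂ (Fin d)) = d := by simp
  have hUo : Module.finrank ℂ Uᗮ = n := by
    have := U.finrank_add_finrank_orthogonal
    omega
  have hVo : Module.finrank ℂ Vᗮ = n := by
    have := V.finrank_add_finrank_orthogonal
    omega
  obtain ⟨p, s, q, c, r, ζ, e₁, e₂, e₃, eζ, hζ, hζd, hk⟩ :=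
    exists_plane_compressions Uᗮ Vᗮ W hUo hVo hWr (hE.symm ▸ h)
  rw [hE] at hζd
  have hUs : ((Uᗮ).starProjection : EuclideanSpace ℂ (Fin d) →ₗ[ℂ] EuclideanSpace ℂ (Fin d)) =
      LinearMap.id - (U.starProjection : _ →ₗ[ℂ] _) := by
    ext1 x; simp [Submodule.starProjection_orthogonal']
  have hVs : ((Vᗮ).starProjection : EuclideanSpace ℂ (Fin d) →ₗ[ℂ] EuclideanSpace ℂ (Fin d)) =
      LinearMap.id - (V.starProjection : _ →ₗ[ℂ] _) := by
    ext1 x; simp [Submodule.starProjection_orthogonal']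
  have hdn : ((d - n : ℕ) : ℂ) = (d : ℂ) - n := Nat.cast_sub (by omega)
  have f₁ : ((P₁ * P₂).trace).re = n - ∑ k, p k := by
    rw [← e₁, trace_mul_eq_trace_comp_toEuclideanLin, hW, hU, hUs, LinearMap.comp_sub, map_sub,
      LinearMap.comp_id, trace_starProjection, hWr]
    simp
  have f₂ : ((P₁ * P₃).trace).re =
      n - ∑ k, (c k ^ 2 * p k + r k ^ 2 * s k + 2 * c k * r k * q k) := by
    rw [← e₂, trace_mul_eq_trace_comp_toEuclideanLin, hW, hV, hVs, LinearMap.comp_sub, map_sub,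
      LinearMap.comp_id, trace_starProjection, hWr]
    simp
  have f₃ : ((P₂ * P₃).trace).re = d - 2 * n + ∑ k, c k ^ 2 := by
    rw [← e₃, Matrix.trace_mul_comm, trace_mul_eq_trace_comp_toEuclideanLin, hU, hV, hUs, hVs,
      LinearMap.comp_sub, LinearMap.sub_comp, LinearMap.sub_comp, map_sub, map_sub, map_sub,
      LinearMap.id_comp, LinearMap.comp_id, LinearMap.id_comp, trace_starProjection,
      trace_starProjection, hUr, hVr, LinearMap.trace_id, hE, hdn]
    simp
    ring
  rw [f₁, f₂, f₃]
  choose l ρ u hl hρ hlρ hu hps hp hβ hc using fun k =>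
    exists_qubit_decomposition (hk k).1 (hk k).2.1 (hk k).2.2.1 (hk k).2.2.2.1
      (hk k).2.2.2.2.1 (hk k).2.2.2.2.2.1 (hk k).2.2.2.2.2.2
  have hC := convex_convexHull ℝ (corrSet 2 1 1 1)
  have hone := subset_convexHull ℝ _ half_half_half_mem_corrSet
  have hsum := hC.sum_smul_mem_smul ⟨_, hone⟩ Finset.univ ρ u (fun k _ => hρ k)
    (fun k _ => subset_convexHull ℝ _ (hu k))
  obtain ⟨y, hy⟩ : ∃ y, y = ∑ k, l k := ⟨_, rfl⟩
  obtain ⟨x, hx⟩ : ∃ x, x = ∑ k, ρ k := ⟨_, rfl⟩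
  have hy0 : 0 ≤ y := hy ▸ Finset.sum_nonneg fun k _ => hl k
  have hx0 : 0 ≤ x := hx ▸ Finset.sum_nonneg fun k _ => hρ k
  have hxy : 2 * y + x + ζ = n := by
    rw [← eζ, Finset.sum_congr rfl fun k _ => hps k, Finset.sum_add_distrib, ← Finset.mul_sum,
      hx, hy]
  have hρ1 : ∀ k, ρ k ≤ 1 := fun k => by linarith [hl k, hlρ k]
  have hc1 : ∀ k, c k ^ 2 ≤ 1 := fun k => by nlinarith [(hk k).1, sq_nonneg (r k)]
  obtain ⟨κ, hκ0, hκ1, hκ⟩ : ∃ κ : ℝ, 0 ≤ κ ∧ κ ≤ 1 ∧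
      ∑ k, c k ^ 2 * (1 - ρ k) = κ * (2 * y + ζ) := by
    have hG0 : 0 ≤ ∑ k, c k ^ 2 * (1 - ρ k) :=
      Finset.sum_nonneg fun k _ => mul_nonneg (sq_nonneg _) (by linarith [hρ1 k])
    have hG1 : ∑ k, c k ^ 2 * (1 - ρ k) ≤ 2 * y + ζ := by
      have : ∑ k, (1 - ρ k) = 2 * y + ζ := by
        rw [Finset.sum_sub_distrib, ← hx]; simp; linarith
      rw [← this]
      exact Finset.sum_le_sum fun k _ =>
        mul_le_of_le_one_left (by linarith [hρ1 k]) (hc1 k)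
    rcases (hG0.trans hG1).eq_or_lt with h0 | h0
    · exact ⟨0, le_rfl, zero_le_one, by linarith⟩
    · exact ⟨_ / (2 * y + ζ), div_nonneg hG0 h0.le, (div_le_one h0).2 hG1, by field_simp⟩
  rw [← hx] at hsum
  obtain ⟨v, hv, hvs⟩ := hsum
  have hη0 : 0 ≤ ζ * (1 - κ) := mul_nonneg hζ (by linarith)
  have hηζ : ζ * (1 - κ) ≤ ζ := mul_le_of_le_one_right hζ (by linarith)
  have hζκ : 0 ≤ ζ * κ := mul_nonneg hζ hκ0
  obtain ⟨z, hz, hzs⟩ : 2 • ∑ k, ρ k • u k + ((4 * y) • (1 / 4, 1 / 4, κ / 2) +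
      (2 * (ζ * κ)) • (1 / 2, 1 / 2, 1 / 2)) ∈
      (2 * (n : ℝ) - 2 * (ζ * (1 - κ))) • convexHull ℝ (corrSet 2 1 1 1) := by
    have : 2 * (n : ℝ) - 2 * (ζ * (1 - κ)) = 2 * x + (4 * y + 2 * (ζ * κ)) := by
      rw [← hxy]; ring
    rw [this, hC.add_smul (by positivity) (by positivity),
      hC.add_smul (by positivity) (by positivity)]
    refine Set.add_mem_add ⟨v, hv, ?_⟩ (Set.add_mem_add
      (Set.smul_mem_smul_set (quarter_quarter_mem_convexHull_corrSet hκ0 hκ1))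
      (Set.smul_mem_smul_set hone))
    rw [← hvs]
    simp only [mul_smul]
    norm_num [two_smul]
  convert mem_typeI_hull hd h hη0 (by linarith) (by linarith) hz using 1
  simp only at hzs
  rw [hzs]
  have g₁ : ∑ k, p k = y + x - 2 * ∑ k, ρ k * (u k).1 := by
    rw [Finset.sum_congr rfl fun k _ => hp k, Finset.sum_sub_distrib, Finset.sum_add_distrib,
      Finset.mul_sum, hx, hy]
  have g₂ : ∑ k, (c k ^ 2 * p k + r k ^ 2 * s k + 2 * c k * r k * q k) =
      y + x - 2 * ∑ k, ρ k * (u k).2.1 := by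
    rw [Finset.sum_congr rfl fun k _ => hβ k, Finset.sum_sub_distrib, Finset.sum_add_distrib,
      Finset.mul_sum, hx, hy]
  have g₃ : ∑ k, c k ^ 2 = 2 * ∑ k, ρ k * (u k).2.2 + κ * (2 * y + ζ) := by
    rw [← hκ, Finset.mul_sum, ← Finset.sum_add_distrib]
    exact Finset.sum_congr rfl fun k _ => by linear_combination ρ k * hc k
  rw [g₁, g₂, g₃, ← hxy]
  ext
  · simp [Prod.fst_sum]; ring
  · simp [Prod.fst_sum, Prod.snd_sum]; ring
  · simp [Prod.snd_sum]; ring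
end
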